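/- Let p ∈ [10/11, 1) and let X be a random walk in the homogeneous 'have your cookie and eat it' environment ω ≡ p with X_0 = 0 almost surely. Then the speed of the walk equals 4p − 3 exactly: lim_{n→∞} X_n/n = 4p − 3 almost surely. -/

import Mathlib

open MeasureTheory Filter

noncomputable section

/-- The hitting time of site `x` by the process `X`, with value `⊤` if `x` is never hit. -/
def hitTime {Ω : Type*} (X : ℕ → Ω → ℤ) (x : ℤ) (ω : Ω) : ℕ∞ :=
  ⨅ (n : ℕ) (_ : X n ω = x), (n : ℕ∞)

/-- The natural filtration of the process `X` at time `n`. -/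
def natSA {Ω : Type*} (X : ℕ → Ω → ℤ) (n : ℕ) : MeasurableSpace Ω :=
  ⨆ m ∈ Finset.range (n + 1), MeasurableSpace.comap (X m) ⊤

/-- The event `A_n` that before time `n` the walk has never jumped leftward from its
current site `X_n`. -/
def freshEvent {Ω : Type*} (X : ℕ → Ω → ℤ) (n : ℕ) : Set Ω :=
  {ω | ∀ m < n, ¬(X m ω = X n ω ∧ X (m + 1) ω = X m ω - 1)}

/-- A random walk in the "have your cookie and eat it" environment `env`. -/
structure IsCookieRW {Ω : Type*} [MeasurableSpace Ω] (P : Measure Ω)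
    (env : ℤ → ℝ) (X : ℕ → Ω → ℤ) : Prop where
  envRange : ∀ x : ℤ, env x ∈ Set.Ico (1 / 2 : ℝ) 1
  meas : ∀ n, Measurable (X n)
  steps : ∀ n : ℕ, ∀ᵐ ω ∂P, |X (n + 1) ω - X n ω| = 1
  cond : ∀ n : ℕ,
    (P[Set.indicator {ω | X (n + 1) ω = X n ω + 1} (fun _ => (1 : ℝ)) | natSA X n])
      =ᵐ[P]
    fun ω => env (X n ω) * Set.indicator (freshEvent X n) (fun _ => (1 : ℝ)) ω
      + (1 / 2) * Set.indicator (freshEvent X n)ᶜ (fun _ => (1 : ℝ)) ω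

open scoped ENNReal Topology

/-- `fairOp ψ a L` is the expectation of `ψ (L + N)`, where `N` is the number of failures before the
`a`-th success in a sequence of fair coin tosses. -/
def fairOp (ψ : ℕ → ℝ≥0∞) : ℕ → ℕ → ℝ≥0∞
  | 0, L => ψ L
  | a + 1, L => ∑' g : ℕ, 2⁻¹ ^ (g + 1) * fairOp ψ a (L + g)

/-- The expectation of `ψ` of the number of left jumps before the `a`-th right jump at a site whose
cookie is intact. -/
def cookieOp (p q : ℝ≥0∞) (ψ : ℕ → ℝ≥0∞) : ℕ → ℝ≥0∞
  | 0 => ψ 0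
  | a + 1 => p * cookieOp p q ψ a + q * fairOp ψ (a + 1) 1

/-- The expectation of `ψ` of the final number of left jumps from a site, given that `L` left jumps
have been made and `a` right jumps are still to be made. -/
def stackOp (p q : ℝ≥0∞) (ψ : ℕ → ℝ≥0∞) (a L : ℕ) : ℝ≥0∞ :=
  if L = 0 then cookieOp p q ψ a else fairOp ψ a L

theorem tsum_inv_two_pow_succ : ∑' g : ℕ, (2⁻¹ : ℝ≥0∞) ^ (g + 1) = 1 := by
  rw [ENNReal.tsum_geometric_add_one, ENNReal.one_sub_inv_two, inv_inv,
    ENNReal.inv_mul_cancel two_ne_zero ENNReal.ofNat_ne_top]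

theorem fairOp_succ (ψ : ℕ → ℝ≥0∞) (a L : ℕ) :
    fairOp ψ (a + 1) L = 2⁻¹ * fairOp ψ a L + 2⁻¹ * fairOp ψ (a + 1) (L + 1) := by
  rw [fairOp, tsum_eq_zero_add' ENNReal.summable, fairOp, ← ENNReal.tsum_mul_left]
  congr 1
  · simp
  · refine tsum_congr fun g => ?_
    rw [pow_succ' _ (g + 1), mul_assoc]
    congr 3
    ring

theorem stackOp_zero (p q : ℝ≥0∞) (ψ : ℕ → ℝ≥0∞) (L : ℕ) : stackOp p q ψ 0 L = ψ L := by
  unfold stackOp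
  split_ifs with h
  · simp [cookieOp, h]
  · simp [fairOp]

theorem stackOp_succ (p q : ℝ≥0∞) (ψ : ℕ → ℝ≥0∞) (a L : ℕ) :
    stackOp p q ψ (a + 1) L = (if L = 0 then p else 2⁻¹) * stackOp p q ψ a L
      + (if L = 0 then q else 2⁻¹) * stackOp p q ψ (a + 1) (L + 1) := by
  rcases eq_or_ne L 0 with rfl | h
  · simp [stackOp, cookieOp]
  · simpa [stackOp, h] using fairOp_succ ψ a L

theorem fairOp_eq_tsum (ψ : ℕ → ℝ≥0∞) (a L : ℕ) :
    fairOp ψ a L = ∑' j, ψ j * fairOp (Pi.single j 1) a L := by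
  induction a generalizing L with
  | zero =>
    simp only [fairOp]
    rw [tsum_eq_single L]
    · simp
    · intro j hj
      simp [hj.symm]
  | succ a ih =>
    simp only [fairOp, ← ENNReal.tsum_mul_left]
    rw [ENNReal.tsum_comm]
    refine tsum_congr fun g => ?_
    rw [ih, ← ENNReal.tsum_mul_left]
    exact tsum_congr fun j => by ring

theorem cookieOp_eq_tsum (p q : ℝ≥0∞) (ψ : ℕ → ℝ≥0∞) (a : ℕ) :
    cookieOp p q ψ a = ∑' j, ψ j * cookieOp p q (Pi.single j 1) a := by
  induction a with
  | zero =>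
    simp only [cookieOp]
    rw [tsum_eq_single 0]
    · simp
    · intro j hj
      simp [hj.symm]
  | succ a ih =>
    simp only [cookieOp, mul_add]
    rw [ENNReal.tsum_add, ih, fairOp_eq_tsum, ← ENNReal.tsum_mul_left, ← ENNReal.tsum_mul_left]
    congr 1 <;> exact tsum_congr fun j => by ring

theorem stackOp_eq_tsum (p q : ℝ≥0∞) (ψ : ℕ → ℝ≥0∞) (a L : ℕ) :
    stackOp p q ψ a L = ∑' j, ψ j * stackOp p q (Pi.single j 1) a L := by
  unfold stackOp
  split_ifs
  · exact cookieOp_eq_tsum p q ψ a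
  · exact fairOp_eq_tsum ψ a L

theorem fairOp_le_one {ψ : ℕ → ℝ≥0∞} (hψ : ∀ j, ψ j ≤ 1) (a L : ℕ) : fairOp ψ a L ≤ 1 := by
  induction a generalizing L with
  | zero => exact hψ L
  | succ a ih =>
    calc ∑' g : ℕ, 2⁻¹ ^ (g + 1) * fairOp ψ a (L + g)
        ≤ ∑' g : ℕ, (2⁻¹ : ℝ≥0∞) ^ (g + 1) :=
          ENNReal.tsum_le_tsum fun g => mul_le_of_le_one_right' (ih _)
      _ = 1 := tsum_inv_two_pow_succ

theorem cookieOp_le_one {p q : ℝ≥0∞} (hpq : p + q = 1) {ψ : ℕ → ℝ≥0∞} (hψ : ∀ j, ψ j ≤ 1)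
    (a : ℕ) : cookieOp p q ψ a ≤ 1 := by
  induction a with
  | zero => exact hψ 0
  | succ a ih =>
    calc p * cookieOp p q ψ a + q * fairOp ψ (a + 1) 1 ≤ p * 1 + q * 1 := by
          gcongr
          exact fairOp_le_one hψ _ _
      _ = 1 := by simpa using hpq

theorem stackOp_le_one {p q : ℝ≥0∞} (hpq : p + q = 1) {ψ : ℕ → ℝ≥0∞} (hψ : ∀ j, ψ j ≤ 1)
    (a L : ℕ) : stackOp p q ψ a L ≤ 1 := by
  unfold stackOp
  split_ifs
  · exact cookieOp_le_one hpq hψ a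
  · exact fairOp_le_one hψ a L

theorem stackOp_single_of_lt (p q : ℝ≥0∞) {z L : ℕ} (h : z < L) (a : ℕ) :
    stackOp p q (Pi.single z 1) a L = 0 := by
  have key : ∀ a L, z < L → fairOp (Pi.single z 1) a L = 0 := by
    intro a
    induction a with
    | zero => intro L h; simp [fairOp, h.ne']
    | succ a ih => intro L h; simp [fairOp, fun i => ih (L + i) (by omega)]
  rw [stackOp, if_neg (by omega), key a L h]

/-- The expectation of `(L + N).choose k`, with `N` as in `fairOp`. -/
def fairMoment : ℕ → ℕ → ℕ → ℕ
  | 0, _, _ => 1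
  | k + 1, a, 0 => a.multichoose (k + 1)
  | k + 1, a, L + 1 => fairMoment (k + 1) a L + fairMoment k a L

theorem fairMoment_zero_right (k a : ℕ) : fairMoment k a 0 = a.multichoose k := by
  cases k <;> simp [fairMoment]

theorem fairMoment_zero_mid (k L : ℕ) : fairMoment k 0 L = L.choose k := by
  induction L generalizing k with
  | zero => cases k <;> simp [fairMoment]
  | succ L ih =>
    cases k with
    | zero => simp [fairMoment]
    | succ k => rw [fairMoment, ih, ih, Nat.choose_succ_succ, add_comm]

theorem fairMoment_succ_mid (k a L : ℕ) :
    fairMoment (k + 1) (a + 1) L = fairMoment (k + 1) a L + fairMoment k (a + 1) L := by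
  induction L generalizing k with
  | zero => simp only [fairMoment_zero_right, Nat.multichoose_succ_succ]
  | succ L ih =>
    cases k with
    | zero => simp [fairMoment, ih]
    | succ k =>
      simp only [fairMoment] at ih ⊢
      rw [ih, ih k]
      ring

theorem exists_fairMoment_le (k a : ℕ) :
    ∃ C : ℝ, 0 ≤ C ∧ ∀ L, (fairMoment k a L : ℝ) ≤ C * (3 / 2) ^ L := by
  induction k with
  | zero => exact ⟨1, one_pos.le, fun L => by simpa [fairMoment] using one_le_pow₀ (by norm_num)⟩
  | succ k ih =>
    obtain ⟨C, hC, h⟩ := ih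
    refine ⟨fairMoment (k + 1) a 0 + 2 * C, by positivity, fun L => ?_⟩
    induction L with
    | zero => simp [hC]
    | succ L ihL =>
      have := h L
      have h1 : (0 : ℝ) ≤ fairMoment (k + 1) a 0 := by positivity
      have h2 : (0 : ℝ) < (3 / 2) ^ L := by positivity
      simp only [fairMoment] at ihL h1 ⊢
      push_cast
      rw [pow_succ]
      nlinarith

theorem tsum_fairMoment (k a L : ℕ) :
    ∑' g : ℕ, 2⁻¹ ^ (g + 1) * (fairMoment k a (L + g) : ℝ≥0∞) = fairMoment k (a + 1) L := by
  have hrec : ∀ g, (2 : ℝ) * fairMoment k (a + 1) g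
      = fairMoment k a g + fairMoment k (a + 1) (g + 1) := by
    intro g
    cases k with
    | zero => norm_num [fairMoment]
    | succ k =>
      have := fairMoment_succ_mid k a g
      rw [fairMoment]
      push_cast [this]
      ring
  have key : HasSum (fun g : ℕ => (2⁻¹ : ℝ) ^ (g + 1) * fairMoment k a (L + g))
      (fairMoment k (a + 1) L) := by
    rw [hasSum_iff_tendsto_nat_of_nonneg fun _ => by positivity]
    have hsum : ∀ n : ℕ, ∑ g ∈ Finset.range n, (2⁻¹ : ℝ) ^ (g + 1) * fairMoment k a (L + g)
        = fairMoment k (a + 1) L - 2⁻¹ ^ n * fairMoment k (a + 1) (L + n) := by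
      intro n
      induction n with
      | zero => simp
      | succ n ih =>
        rw [Finset.sum_range_succ, ih, ← add_assoc, pow_succ]
        linear_combination (-(2⁻¹ : ℝ) ^ n * 2⁻¹) * hrec (L + n)
    simp only [hsum]
    rw [← tendsto_const_sub_iff (b := (fairMoment k (a + 1) L : ℝ))]
    simp only [sub_sub_cancel, sub_self]
    obtain ⟨C, hC, h⟩ := exists_fairMoment_le k (a + 1)
    refine squeeze_zero (g := fun n => C * (3 / 2) ^ L * (3 / 4 : ℝ) ^ n)
      (fun n => by positivity) (fun n => ?_) ?_
    · calc (2⁻¹ : ℝ) ^ n * fairMoment k (a + 1) (L + n)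
          ≤ 2⁻¹ ^ n * (C * (3 / 2) ^ (L + n)) := by gcongr; exact h _
        _ = C * (3 / 2) ^ L * (2⁻¹ * (3 / 2)) ^ n := by rw [pow_add, mul_pow]; ring
        _ = _ := by norm_num
    · simpa using (tendsto_pow_atTop_nhds_zero_of_lt_one (r := (3 / 4 : ℝ)) (by norm_num)
        (by norm_num)).const_mul (C * (3 / 2) ^ L)
  have := ENNReal.ofReal_tsum_of_nonneg (fun g => by positivity) key.summable
  rw [key.tsum_eq, ENNReal.ofReal_natCast] at this
  rw [this]
  refine tsum_congr fun g => ?_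
  rw [ENNReal.ofReal_mul (by positivity), ENNReal.ofReal_pow (by positivity),
    ENNReal.ofReal_natCast, ENNReal.ofReal_inv_of_pos (by norm_num)]
  simp

/-- The functions `z ↦ z.choose (k + 2) + r * z.choose (k + 1)`, on which `stackOp` acts
explicitly. -/
def lyap (r : ℝ≥0∞) (k z : ℕ) : ℝ≥0∞ := z.choose (k + 2) + r * z.choose (k + 1)

theorem fairOp_lyap (r : ℝ≥0∞) (k a L : ℕ) :
    fairOp (lyap r k) a L = fairMoment (k + 2) a L + r * fairMoment (k + 1) a L := by
  induction a generalizing L with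
  | zero => simp [fairOp, lyap, fairMoment_zero_mid]
  | succ a ih =>
    simp only [fairOp, ih, mul_add]
    rw [ENNReal.tsum_add, tsum_fairMoment, ← tsum_fairMoment (k + 1), ← ENNReal.tsum_mul_left]
    congr 1
    exact tsum_congr fun g => by ring

theorem stackOp_lyap {p q r : ℝ≥0∞} (hpq : p + q = 1) (hr : q * r = p) (k a : ℕ) :
    stackOp p q (lyap r k) a 0 = a.multichoose (k + 2) + a.multichoose (k + 1) := by
  rw [stackOp, if_pos rfl]
  induction a with
  | zero => simp [cookieOp, lyap]
  | succ a ih =>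
    have hone : ∀ j b, fairMoment (j + 1) b 1 = b.multichoose (j + 1) + b.multichoose j := by
      intro j b
      rw [fairMoment, fairMoment_zero_right, fairMoment_zero_right]
    have h1 : ((a + 1).multichoose (k + 2) : ℝ≥0∞)
        = a.multichoose (k + 2) + (a + 1).multichoose (k + 1) := by
      exact_mod_cast Nat.multichoose_succ_succ a (k + 1)
    have h2 : ((a + 1).multichoose (k + 1) : ℝ≥0∞)
        = a.multichoose (k + 1) + (a + 1).multichoose k := by
      exact_mod_cast Nat.multichoose_succ_succ a k
    rw [cookieOp, ih, fairOp_lyap, mul_add q, ← mul_assoc, hr, hone, hone]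
    push_cast
    calc _ = p * ((a.multichoose (k + 2) + (a + 1).multichoose (k + 1))
            + (a.multichoose (k + 1) + (a + 1).multichoose k))
          + q * ((a + 1).multichoose (k + 2) + (a + 1).multichoose (k + 1)) := by ring
      _ = (p + q) * ((a + 1).multichoose (k + 2) + (a + 1).multichoose (k + 1)) := by
          rw [← h1, ← h2]; ring
      _ = _ := by rw [hpq, one_mul]

/-- The number of left jumps from `y` made by the path `x` before time `k`, when `x` is stopped upon
reaching `n`. -/
def leftCount (n : ℕ) (x : ℕ → ℤ) (y : ℤ) (k : ℕ) : ℕ :=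
  Nat.count (fun j => (∀ i ≤ j, x i < n) ∧ x j = y ∧ x (j + 1) = y - 1) k

/-- The number of right jumps from `y` made by the path `x` before time `k`, when `x` is stopped upon
reaching `n`. -/
def rightCount (n : ℕ) (x : ℕ → ℤ) (y : ℤ) (k : ℕ) : ℕ :=
  Nat.count (fun j => (∀ i ≤ j, x i < n) ∧ x j = y ∧ x (j + 1) = y + 1) k

/-- A nearest-neighbour path on the integers started at the origin. -/
structure IsPath (x : ℕ → ℤ) : Prop where
  zero : x 0 = 0
  step : ∀ k, x (k + 1) = x k + 1 ∨ x (k + 1) = x k - 1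

theorem leftCount_succ (n : ℕ) (x : ℕ → ℤ) (y : ℤ) (k : ℕ) :
    leftCount n x y (k + 1) = leftCount n x y k
      + if (∀ i ≤ k, x i < n) ∧ x k = y ∧ x (k + 1) = y - 1 then 1 else 0 :=
  Nat.count_succ _ _

theorem rightCount_succ (n : ℕ) (x : ℕ → ℤ) (y : ℤ) (k : ℕ) :
    rightCount n x y (k + 1) = rightCount n x y k
      + if (∀ i ≤ k, x i < n) ∧ x k = y ∧ x (k + 1) = y + 1 then 1 else 0 :=
  Nat.count_succ _ _

theorem leftCount_congr {n k : ℕ} {x x' : ℕ → ℤ} (h : ∀ j ≤ k, x j = x' j) (y : ℤ) :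
    leftCount n x y k = leftCount n x' y k := by
  induction k with
  | zero => rfl
  | succ k ih =>
    rw [leftCount_succ, leftCount_succ, ih fun j hj => h j (by omega), h k (by omega),
      h (k + 1) le_rfl]
    have : (∀ i ≤ k, x i < n) ↔ ∀ i ≤ k, x' i < n :=
      forall₂_congr fun i hi => by rw [h i (by omega)]
    simp only [this]

theorem rightCount_congr {n k : ℕ} {x x' : ℕ → ℤ} (h : ∀ j ≤ k, x j = x' j) (y : ℤ) :
    rightCount n x y k = rightCount n x' y k := by
  induction k with
  | zero => rfl
  | succ k ih =>
    rw [rightCount_succ, rightCount_succ, ih fun j hj => h j (by omega), h k (by omega),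
      h (k + 1) le_rfl]
    have : (∀ i ≤ k, x i < n) ↔ ∀ i ≤ k, x' i < n :=
      forall₂_congr fun i hi => by rw [h i (by omega)]
    simp only [this]

theorem leftCount_update (n k : ℕ) (x : ℕ → ℤ) (y v : ℤ) :
    leftCount n (Function.update x (k + 1) v) y (k + 1) = leftCount n x y k
      + if (∀ i ≤ k, x i < n) ∧ x k = y ∧ v = y - 1 then 1 else 0 := by
  have h : ∀ j ≤ k, Function.update x (k + 1) v j = x j := fun j hj =>
    Function.update_of_ne (by omega) _ _
  have : (∀ i ≤ k, Function.update x (k + 1) v i < n) ↔ ∀ i ≤ k, x i < n :=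
    forall₂_congr fun i hi => by rw [h i hi]
  rw [leftCount_succ, leftCount_congr h, h k le_rfl]
  simp only [this, Function.update_self]

theorem rightCount_update (n k : ℕ) (x : ℕ → ℤ) (y v : ℤ) :
    rightCount n (Function.update x (k + 1) v) y (k + 1) = rightCount n x y k
      + if (∀ i ≤ k, x i < n) ∧ x k = y ∧ v = y + 1 then 1 else 0 := by
  have h : ∀ j ≤ k, Function.update x (k + 1) v j = x j := fun j hj =>
    Function.update_of_ne (by omega) _ _
  have : (∀ i ≤ k, Function.update x (k + 1) v i < n) ↔ ∀ i ≤ k, x i < n :=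
    forall₂_congr fun i hi => by rw [h i hi]
  rw [rightCount_succ, rightCount_congr h, h k le_rfl]
  simp only [this, Function.update_self]

theorem leftCount_eq_zero_of_le {n : ℕ} (x : ℕ → ℤ) {y : ℤ} (hy : n ≤ y) (k : ℕ) :
    leftCount n x y k = 0 := by
  induction k with
  | zero => rfl
  | succ k ih =>
    rw [leftCount_succ, ih, if_neg]
    rintro ⟨h, h', -⟩
    have := h k le_rfl
    omega

/-- The net flow across each edge up to time `k`. -/
theorem IsPath.rightCount_eq {x : ℕ → ℤ} (hx : IsPath x) {n k : ℕ} (hk : ∀ j < k, x j < n)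
    (y : ℤ) :
    (rightCount n x y k : ℤ) = leftCount n x (y + 1) k + (if 0 ≤ y ∧ y < x k then 1 else 0)
      - (if x k ≤ y ∧ y < 0 then 1 else 0) := by
  induction k with
  | zero =>
    rw [if_neg (by rw [hx.zero]; omega), if_neg (by rw [hx.zero]; omega)]
    simp [rightCount, leftCount]
  | succ k ih =>
    have ih := ih fun j hj => hk j (by omega)
    have hal : ∀ i ≤ k, x i < n := fun i hi => hk i (by omega)
    rw [rightCount_succ, leftCount_succ]
    simp only [show (∀ i ≤ k, x i < (n : ℤ)) ↔ True from iff_true_intro hal, true_and]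
    push_cast
    rw [ih]
    rcases hx.step k with h | h <;> rw [h] <;> split_ifs <;> omega

theorem fresh_iff_leftCount_eq_zero {x : ℕ → ℤ} {n k : ℕ} (hk : ∀ j ≤ k, x j < n) :
    (∀ m < k, ¬(x m = x k ∧ x (m + 1) = x m - 1)) ↔ leftCount n x (x k) k = 0 := by
  unfold leftCount
  rw [Nat.count_eq_card_filter_range, Finset.card_eq_zero, Finset.filter_eq_empty_iff]
  simp only [Finset.mem_range]
  refine forall₂_congr fun m hm => not_congr ⟨fun h => ⟨fun i hi => hk i (by omega), h.1, ?_⟩,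
    fun h => ⟨h.2.1, ?_⟩⟩
  · rw [h.2, h.1]
  · rw [h.2.2, h.2.1]

/-- The conditional probability, given the path `x` up to time `k`, that the final numbers of left
jumps from `n - 1, …, n - I` are `z 1, …, z I`. -/
def pot (p q : ℝ≥0∞) (n I : ℕ) (z : ℕ → ℕ) (x : ℕ → ℤ) (k : ℕ) : ℝ≥0∞ :=
  ∏ i ∈ Finset.range I, stackOp p q (Pi.single (z (i + 1)) 1)
    (z i + (if i < n then 1 else 0) - rightCount n x (n - i - 1) k) (leftCount n x (n - i - 1) k)

theorem pot_congr (p q : ℝ≥0∞) (n I : ℕ) (z : ℕ → ℕ) {x x' : ℕ → ℤ} {k : ℕ}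
    (h : ∀ j ≤ k, x j = x' j) : pot p q n I z x k = pot p q n I z x' k := by
  simp only [pot, leftCount_congr h, rightCount_congr h]

theorem pot_le_one {p q : ℝ≥0∞} (hpq : p + q = 1) (n I : ℕ) (z : ℕ → ℕ) (x : ℕ → ℤ) (k : ℕ) :
    pot p q n I z x k ≤ 1 := by
  refine Finset.prod_le_one' fun i _ => stackOp_le_one hpq (fun j => ?_) _ _
  by_cases h : j = z (i + 1) <;> simp [h]

theorem IsPath.pot_step {p q : ℝ≥0∞} (hpq : p + q = 1) {n : ℕ} (I : ℕ) {z : ℕ → ℕ} (hz : z 0 = 0)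
    {x : ℕ → ℤ} (hx : IsPath x) (k : ℕ) :
    pot p q n I z x k
      = (if ∀ m < k, ¬(x m = x k ∧ x (m + 1) = x m - 1) then p else 2⁻¹)
          * pot p q n I z (Function.update x (k + 1) (x k + 1)) (k + 1)
        + (if ∀ m < k, ¬(x m = x k ∧ x (m + 1) = x m - 1) then q else 2⁻¹)
          * pot p q n I z (Function.update x (k + 1) (x k - 1)) (k + 1) := by
  have hsum : ∀ c : ℝ≥0∞, c = (if ∀ m < k, ¬(x m = x k ∧ x (m + 1) = x m - 1) then p else 2⁻¹) * c
      + (if ∀ m < k, ¬(x m = x k ∧ x (m + 1) = x m - 1) then q else 2⁻¹) * c := by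
    intro c
    rw [← add_mul]
    split_ifs
    · rw [hpq, one_mul]
    · rw [ENNReal.inv_two_add_inv_two, one_mul]
  unfold pot
  simp only [leftCount_update, rightCount_update]
  by_cases hal : ∀ i ≤ k, x i < n
  swap
  · simpa only [hal, false_and, if_false, add_zero] using hsum _
  simp only [show (∀ i ≤ k, x i < (n : ℤ)) ↔ True from iff_true_intro hal, true_and]
  simp only [fresh_iff_leftCount_eq_zero hal] at *
  have hxk := hal k le_rfl
  obtain ⟨i₀, hi₀⟩ : ∃ i₀ : ℕ, x k = n - i₀ - 1 := ⟨(n - 1 - x k).toNat, by omega⟩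
  have hother : ∀ i ≠ i₀, ¬ (x k = (n : ℤ) - i - 1) := by intro i hi; omega
  by_cases hI : i₀ ∈ Finset.range I
  swap
  · have : ∀ i ∈ Finset.range I, ¬ (x k = (n : ℤ) - i - 1) := fun i hi =>
      hother i (by rintro rfl; exact hI hi)
    convert hsum _ using 3 <;>
    · refine Finset.prod_congr rfl fun i hi => ?_
      simp [this i hi]
  simp only [← Finset.mul_prod_erase _ _ hI]
  have hrest : ∀ v : ℤ, ∏ i ∈ (Finset.range I).erase i₀,
      stackOp p q (Pi.single (z (i + 1)) 1) (z i + (if i < n then 1 else 0)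
        - (rightCount n x (n - i - 1) k + if x k = n - i - 1 ∧ v = n - i - 1 + 1 then 1 else 0))
        (leftCount n x (n - i - 1) k + if x k = n - i - 1 ∧ v = n - i - 1 - 1 then 1 else 0)
      = ∏ i ∈ (Finset.range I).erase i₀, stackOp p q (Pi.single (z (i + 1)) 1)
        (z i + (if i < n then 1 else 0) - rightCount n x (n - i - 1) k)
        (leftCount n x (n - i - 1) k) := by
    intro v
    refine Finset.prod_congr rfl fun i hi => ?_
    simp [hother i (Finset.ne_of_mem_erase hi)]
  rw [hrest, hrest]
  simp only [← hi₀, true_and, if_true]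
  rw [if_neg (show ¬ x k + 1 = x k - 1 by omega), if_neg (show ¬ x k - 1 = x k + 1 by omega)]
  simp only [add_zero]
  set rest := ∏ i ∈ (Finset.range I).erase i₀, stackOp p q (Pi.single (z (i + 1)) 1)
        (z i + (if i < n then 1 else 0) - rightCount n x (n - i - 1) k)
        (leftCount n x (n - i - 1) k) with hrest_def
  rw [← mul_assoc, ← mul_assoc, ← add_mul]
  have hflow := hx.rightCount_eq (fun j hj => hal j (le_of_lt hj)) (x k)
  by_cases hle : leftCount n x (x k + 1) k ≤ z i₀
  · congr 1
    obtain ⟨a, ha⟩ : ∃ a, z i₀ + (if i₀ < n then 1 else 0) = a + 1 + rightCount n x (x k) k := by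
      refine ⟨z i₀ + (if i₀ < n then 1 else 0) - 1 - rightCount n x (x k) k, ?_⟩
      split_ifs at hflow ⊢ <;> omega
    rw [ha, Nat.add_sub_cancel, stackOp_succ]
    congr 3
    omega
  · have : rest = 0 := by
      have hi : i₀ ≠ 0 := by
        rintro rfl
        rw [leftCount_eq_zero_of_le x (by omega)] at hle
        omega
      obtain ⟨j, rfl⟩ := Nat.exists_eq_succ_of_ne_zero hi
      refine Finset.prod_eq_zero (i := j)
        (Finset.mem_erase.2 ⟨by omega, Finset.mem_range.2 (by have := Finset.mem_range.1 hI; omega)⟩)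
        ?_
      refine stackOp_single_of_lt p q ?_ _
      rw [show (n : ℤ) - j - 1 = x k + 1 by push_cast at hi₀; omega]
      exact not_le.1 hle
    rw [this, mul_zero, mul_zero]

/-- The first time at which the path `x` is at or above `n`. -/
def hitNat (x : ℕ → ℤ) (hx : ∀ n : ℕ, ∃ k, (n : ℤ) ≤ x k) (n : ℕ) : ℕ := Nat.find (hx n)

theorem lt_of_lt_hitNat {x : ℕ → ℤ} (hx : ∀ n : ℕ, ∃ k, (n : ℤ) ≤ x k) {n j : ℕ}
    (hj : j < hitNat x hx n) : x j < n :=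
  not_le.1 (Nat.find_min (hx n) hj)

theorem IsPath.apply_hitNat {x : ℕ → ℤ} (hp : IsPath x) (hx : ∀ n : ℕ, ∃ k, (n : ℤ) ≤ x k)
    (n : ℕ) : x (hitNat x hx n) = n := by
  have h := Nat.find_spec (hx n)
  change (n : ℤ) ≤ x (hitNat x hx n) at h
  rcases Nat.eq_zero_or_pos (hitNat x hx n) with h0 | h0
  · rw [h0, hp.zero] at h ⊢
    omega
  · obtain ⟨m, hm⟩ := Nat.exists_eq_succ_of_ne_zero h0.ne'
    have h1 := lt_of_lt_hitNat hx (show m < hitNat x hx n by omega)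
    have := hp.step m
    rw [hm, Nat.succ_eq_add_one] at h ⊢
    omega

theorem leftCount_of_hitNat_le {x : ℕ → ℤ} (hx : ∀ n : ℕ, ∃ k, (n : ℤ) ≤ x k) {n k : ℕ} (y : ℤ)
    (hk : hitNat x hx n ≤ k) : leftCount n x y k = leftCount n x y (hitNat x hx n) := by
  induction k, hk using Nat.le_induction with
  | base => rfl
  | succ k hk ih =>
    rw [leftCount_succ, ih, if_neg, add_zero]
    exact fun h => absurd (h.1 _ hk) (not_lt.2 (Nat.find_spec (hx n)))

theorem rightCount_of_hitNat_le {x : ℕ → ℤ} (hx : ∀ n : ℕ, ∃ k, (n : ℤ) ≤ x k) {n k : ℕ} (y : ℤ)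
    (hk : hitNat x hx n ≤ k) : rightCount n x y k = rightCount n x y (hitNat x hx n) := by
  induction k, hk using Nat.le_induction with
  | base => rfl
  | succ k hk ih =>
    rw [rightCount_succ, ih, if_neg, add_zero]
    exact fun h => absurd (h.1 _ hk) (not_lt.2 (Nat.find_spec (hx n)))

theorem IsPath.pot_final {p q : ℝ≥0∞} {n : ℕ} (I : ℕ) {z : ℕ → ℕ} (hz : z 0 = 0)
    {x : ℕ → ℤ} (hp : IsPath x) (hx : ∀ n : ℕ, ∃ k, (n : ℤ) ≤ x k) {k : ℕ}
    (hk : hitNat x hx n ≤ k) :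
    pot p q n I z x k
      = if ∀ i ≤ I, leftCount n x (n - i) (hitNat x hx n) = z i then 1 else 0 := by
  unfold pot
  simp only [leftCount_of_hitNat_le hx _ hk, rightCount_of_hitNat_le hx _ hk]
  have hflow := hp.rightCount_eq (fun j hj => lt_of_lt_hitNat hx hj) (n := n)
  rw [hp.apply_hitNat hx] at hflow
  have hfac : ∀ i : ℕ, leftCount n x (n - i) (hitNat x hx n) = z i →
      z i + (if i < n then 1 else 0) - rightCount n x (n - i - 1) (hitNat x hx n) = 0 := by
    intro i hi
    have := hflow (n - i - 1)
    rw [sub_add_cancel, hi] at this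
    split_ifs at this ⊢ <;> omega
  have hshift : ∀ i : ℕ, (n : ℤ) - i - 1 = n - (i + 1 : ℕ) := by intro i; push_cast; ring
  split_ifs with h
  · refine Finset.prod_eq_one fun i hi => ?_
    have hi := Finset.mem_range.1 hi
    rw [hfac i (h i (by omega)), stackOp_zero, hshift, h (i + 1) (by omega), Pi.single_eq_same]
  · push Not at h
    obtain ⟨hi, hne⟩ := Nat.find_spec h
    have hmin : ∀ j < Nat.find h, leftCount n x (n - j) (hitNat x hx n) = z j := fun j hj => by
      have := Nat.find_min h hj
      push Not at this
      exact this (by omega)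
    have h0 : Nat.find h ≠ 0 := by
      intro h0
      rw [h0] at hne
      exact hne (by rw [hz, leftCount_eq_zero_of_le x (by simp)])
    obtain ⟨j, hj⟩ := Nat.exists_eq_succ_of_ne_zero h0
    refine Finset.prod_eq_zero (i := j) (Finset.mem_range.2 (by omega)) ?_
    rw [hfac j (hmin j (by omega)), stackOp_zero, hshift, Pi.single_apply, if_neg]
    rwa [hj] at hne

theorem IsPath.hitNat_eq {x : ℕ → ℤ} (hp : IsPath x) (hx : ∀ n : ℕ, ∃ k, (n : ℤ) ≤ x k)
    (n : ℕ) :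
    (hitNat x hx n : ℝ≥0∞) = n + 2 * ∑' i : ℕ, (leftCount n x (n - i) (hitNat x hx n) : ℝ≥0∞) := by
  have key : ∀ k ≤ hitNat x hx n, ∃ l : ℕ, ∑' i : ℕ, (leftCount n x (n - i) k : ℝ≥0∞) = l
      ∧ (k : ℤ) = x k + 2 * l := by
    intro k
    induction k with
    | zero => exact fun _ => ⟨0, by simp [leftCount], by simp [hp.zero]⟩
    | succ k ih =>
      intro hk
      obtain ⟨l, hl, hkl⟩ := ih (by omega)
      have hal : ∀ i ≤ k, x i < n := fun i hi => lt_of_lt_hitNat hx (by omega)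
      have hxk := hal k le_rfl
      simp only [leftCount_succ, Nat.cast_add, ENNReal.tsum_add, hl,
        show (∀ i ≤ k, x i < (n : ℤ)) ↔ True from iff_true_intro hal, true_and]
      rcases hp.step k with h | h
      · refine ⟨l, ?_, by rw [h]; push_cast; omega⟩
        rw [ENNReal.tsum_eq_zero.2 fun i => ?_, add_zero]
        rw [if_neg (by omega), Nat.cast_zero]
      · refine ⟨l + 1, ?_, by rw [h]; push_cast; omega⟩
        rw [tsum_eq_single (n - x k).toNat]
        · rw [if_pos (by omega)]
          simp
        · intro i hi
          rw [if_neg (by omega), Nat.cast_zero]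
  obtain ⟨l, hl, hkl⟩ := key _ le_rfl
  rw [hl]
  rw [hp.apply_hitNat hx] at hkl
  exact_mod_cast hkl

/-- Two functions have the same integral if they do on each fibre of a map with countable range. -/
theorem lintegral_congr_of_fiber {Ω α : Type*} [MeasurableSpace Ω] {P : Measure Ω} [Countable α]
    [MeasurableSpace α] [MeasurableSingletonClass α] {H : Ω → α} (hH : Measurable H)
    {F G : Ω → ℝ≥0∞}
    (h : ∀ ω₀, ∫⁻ ω in H ⁻¹' {H ω₀}, F ω ∂P = ∫⁻ ω in H ⁻¹' {H ω₀}, G ω ∂P) :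
    ∫⁻ ω, F ω ∂P = ∫⁻ ω, G ω ∂P := by
  have hcover : (⋃ a, H ⁻¹' {a}) = Set.univ := by ext; simp
  have hdisj : Pairwise (Function.onFun Disjoint fun a => H ⁻¹' {a}) := fun a b hab =>
    Disjoint.preimage _ (by simpa using hab)
  rw [← setLIntegral_univ, ← setLIntegral_univ G, ← hcover,
    lintegral_iUnion (fun a => hH (measurableSet_singleton a)) hdisj,
    lintegral_iUnion (fun a => hH (measurableSet_singleton a)) hdisj]
  refine tsum_congr fun a => ?_
  rcases (H ⁻¹' {a}).eq_empty_or_nonempty with h0 | ⟨ω₀, rfl⟩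
  · simp [h0]
  · exact h ω₀

/-- The history of a process up to time `k`. -/
def hist {Ω β : Type*} (X : ℕ → Ω → β) (k : ℕ) (ω : Ω) (j : Fin (k + 1)) : β := X j ω

theorem measurable_hist {Ω β : Type*} [MeasurableSpace Ω] [MeasurableSpace β] {X : ℕ → Ω → β}
    (hX : ∀ k, Measurable (X k)) (k : ℕ) : Measurable (hist X k) :=
  measurable_pi_lambda _ fun j => hX j

theorem hist_eq_iff {Ω β : Type*} {X : ℕ → Ω → β} {k : ℕ} {ω ω₀ : Ω} :
    hist X k ω = hist X k ω₀ ↔ ∀ j ≤ k, X j ω = X j ω₀ := by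
  rw [funext_iff]
  exact ⟨fun h j hj => h ⟨j, by omega⟩, fun h j => h j (by omega)⟩

/-- A function of the history up to time `k` of a process in a countable space is measurable. -/
theorem measurable_of_hist {Ω β γ : Type*} [MeasurableSpace Ω] [MeasurableSpace β] [Countable β]
    [MeasurableSingletonClass β] [MeasurableSpace γ] [Nonempty γ] {X : ℕ → Ω → β}
    (hX : ∀ k, Measurable (X k)) {k : ℕ} {F : Ω → γ}
    (hF : ∀ ω ω', (∀ j ≤ k, X j ω = X j ω') → F ω = F ω') : Measurable F := by
  have : Function.FactorsThrough F (hist X k) := fun ω ω' h => hF ω ω' (hist_eq_iff.1 h)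
  rw [← this.extend_comp (fun _ => Classical.arbitrary γ)]
  exact (measurable_of_countable _).comp (measurable_hist hX k)

/-- A process all of whose paths are nearest-neighbour paths from the origin that are unbounded
above, and which follows the law of the cookie random walk: its next jump from a site which it has
not yet left leftward is to the right or left with probabilities `p` and `q`, and its jumps from
other sites are symmetric. -/
structure IsRegularWalk {Ω : Type*} [MeasurableSpace Ω] (P : Measure Ω) (p q : ℝ≥0∞)
    (X : ℕ → Ω → ℤ) : Prop where
  meas : ∀ k, Measurable (X k)
  path : ∀ ω, IsPath fun k => X k ω
  unbdd : ∀ ω, ∀ n : ℕ, ∃ k, (n : ℤ) ≤ X k ω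
  right : ∀ k ω₀, P (hist X k ⁻¹' {hist X k ω₀} ∩ {ω | X (k + 1) ω = X k ω + 1})
    = (if ∀ m < k, ¬(X m ω₀ = X k ω₀ ∧ X (m + 1) ω₀ = X m ω₀ - 1) then p else 2⁻¹)
      * P (hist X k ⁻¹' {hist X k ω₀})
  left : ∀ k ω₀, P (hist X k ⁻¹' {hist X k ω₀} ∩ {ω | X (k + 1) ω = X k ω + 1}ᶜ)
    = (if ∀ m < k, ¬(X m ω₀ = X k ω₀ ∧ X (m + 1) ω₀ = X m ω₀ - 1) then q else 2⁻¹)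
      * P (hist X k ⁻¹' {hist X k ω₀})

namespace IsRegularWalk

variable {Ω : Type*} [MeasurableSpace Ω] {P : Measure Ω} {p q : ℝ≥0∞} {X : ℕ → Ω → ℤ}

theorem measurable_of_congr (hX : IsRegularWalk P p q X) {γ : Type*} [MeasurableSpace γ]
    [Nonempty γ] {k : ℕ} {Φ : (ℕ → ℤ) → γ} (hΦ : ∀ x x', (∀ j ≤ k, x j = x' j) → Φ x = Φ x') :
    Measurable fun ω => Φ fun j => X j ω :=
  measurable_of_hist hX.meas fun _ _ h => hΦ _ _ h

/-- One step of the martingale. -/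
theorem lintegral_pot_succ (hX : IsRegularWalk P p q X) (hpq : p + q = 1) {n : ℕ} (I : ℕ)
    {z : ℕ → ℕ} (hz : z 0 = 0) (k : ℕ) :
    ∫⁻ ω, pot p q n I z (fun j => X j ω) (k + 1) ∂P = ∫⁻ ω, pot p q n I z (fun j => X j ω) k ∂P := by
  refine lintegral_congr_of_fiber (measurable_hist hX.meas k) fun ω₀ => ?_
  set B := hist X k ⁻¹' {hist X k ω₀} with hB
  have hBm : MeasurableSet B := measurable_hist hX.meas k (measurableSet_singleton _)
  have hBj : ∀ ω ∈ B, ∀ j ≤ k, X j ω = X j ω₀ := fun ω hω => hist_eq_iff.1 hω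
  set R := {ω | X (k + 1) ω = X k ω + 1} with hR
  have hRm : MeasurableSet R :=
    measurableSet_eq_fun (hX.meas _) ((hX.meas k).add_const 1)
  set x₀ : ℕ → ℤ := fun j => X j ω₀ with hx₀
  have hupd : ∀ ω ∈ B, ∀ v, X (k + 1) ω = v → ∀ j ≤ k + 1,
      X j ω = Function.update x₀ (k + 1) v j := by
    intro ω hω v hv j hj
    rcases eq_or_ne j (k + 1) with rfl | hne
    · simpa using hv
    · rw [Function.update_of_ne hne]
      exact hBj ω hω j (by omega)
  rw [← lintegral_inter_add_sdiff _ B hRm]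
  have h1 : ∫⁻ ω in B ∩ R, pot p q n I z (fun j => X j ω) (k + 1) ∂P
      = ∫⁻ ω in B ∩ R, pot p q n I z (Function.update x₀ (k + 1) (x₀ k + 1)) (k + 1) ∂P := by
    refine setLIntegral_congr_fun (hBm.inter hRm) fun ω hω => pot_congr _ _ _ _ _ ?_
    refine hupd ω hω.1 _ ?_
    rw [hω.2, hBj ω hω.1 k le_rfl]
  have h2 : ∫⁻ ω in B \ R, pot p q n I z (fun j => X j ω) (k + 1) ∂P
      = ∫⁻ ω in B \ R, pot p q n I z (Function.update x₀ (k + 1) (x₀ k - 1)) (k + 1) ∂P := by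
    refine setLIntegral_congr_fun (hBm.diff hRm) fun ω hω => pot_congr _ _ _ _ _ ?_
    refine hupd ω hω.1 _ ?_
    rw [((hX.path ω).step k).resolve_left hω.2, hBj ω hω.1 k le_rfl]
  have h3 : ∫⁻ ω in B, pot p q n I z (fun j => X j ω) k ∂P = ∫⁻ ω in B, pot p q n I z x₀ k ∂P :=
    setLIntegral_congr_fun hBm fun ω hω => pot_congr _ _ _ _ _ (hBj ω hω)
  rw [h1, h2, h3, setLIntegral_const, setLIntegral_const, setLIntegral_const, Set.sdiff_eq,
    hX.right, hX.left, (hX.path ω₀).pot_step hpq I hz k, add_mul]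
  simp only [← hB]
  ring

/-- The number of left jumps from `n - i` before reaching `n`. -/
def tally (hX : IsRegularWalk P p q X) (n i : ℕ) (ω : Ω) : ℕ :=
  leftCount n (fun k => X k ω) (n - i) (hitNat (fun k => X k ω) (hX.unbdd ω) n)

theorem measurable_tally (hX : IsRegularWalk P p q X) (n i : ℕ) : Measurable (hX.tally n i) := by
  refine measurable_of_tendsto_metrizable (f := fun k ω => leftCount n (fun k => X k ω) (n - i) k)
    (fun k => hX.measurable_of_congr fun x x' h => leftCount_congr h _) ?_
  refine tendsto_pi_nhds.2 fun ω => tendsto_const_nhds.congr' ?_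
  filter_upwards [eventually_ge_atTop (hitNat (fun k => X k ω) (hX.unbdd ω) n)] with k hk
  exact (leftCount_of_hitNat_le (hX.unbdd ω) _ hk).symm

theorem tally_zero (hX : IsRegularWalk P p q X) (n : ℕ) (ω : Ω) : hX.tally n 0 ω = 0 :=
  leftCount_eq_zero_of_le _ (by simp) _

theorem prob_tally (hX : IsRegularWalk P p q X) [IsProbabilityMeasure P] (hpq : p + q = 1)
    (n I : ℕ) {z : ℕ → ℕ} (hz : z 0 = 0) :
    P {ω | ∀ i ≤ I, hX.tally n i ω = z i} = ∏ i ∈ Finset.range I,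
      stackOp p q (Pi.single (z (i + 1)) 1) (z i + if i < n then 1 else 0) 0 := by
  have hconst : ∀ k, ∫⁻ ω, pot p q n I z (fun j => X j ω) k ∂P = ∏ i ∈ Finset.range I,
      stackOp p q (Pi.single (z (i + 1)) 1) (z i + if i < n then 1 else 0) 0 := by
    intro k
    induction k with
    | zero => simp [pot, leftCount, rightCount]
    | succ k ih => rw [hX.lintegral_pot_succ hpq I hz, ih]
  have hmeas : MeasurableSet {ω | ∀ i ≤ I, hX.tally n i ω = z i} := by
    have : {ω | ∀ i ≤ I, hX.tally n i ω = z i} = ⋂ i ≤ I, hX.tally n i ⁻¹' {z i} := by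
      ext; simp
    rw [this]
    exact MeasurableSet.biInter (Set.to_countable _) fun i _ =>
      hX.measurable_tally n i (measurableSet_singleton _)
  have hlim := tendsto_lintegral_of_dominated_convergence (μ := P)
    (F := fun k ω => pot p q n I z (fun j => X j ω) k)
    (f := Set.indicator {ω | ∀ i ≤ I, hX.tally n i ω = z i} 1) (fun _ => 1)
    (fun k => hX.measurable_of_congr fun x x' h => pot_congr _ _ _ _ _ h)
    (fun k => Eventually.of_forall fun ω => pot_le_one hpq _ _ _ _ _) (by simp)
    (Eventually.of_forall fun ω => by
      refine tendsto_const_nhds.congr' ?_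
      filter_upwards [eventually_ge_atTop (hitNat (fun k => X k ω) (hX.unbdd ω) n)] with k hk
      rw [(hX.path ω).pot_final I hz (hX.unbdd ω) hk]
      simp only [Set.indicator_apply, Set.mem_ofPred_eq, Pi.one_apply]
      rfl)
  simp only [hconst, lintegral_indicator_one hmeas] at hlim
  exact (tendsto_nhds_unique hlim tendsto_const_nhds)

end IsRegularWalk

/-- A Markov chain on the natural numbers, started at `0`, whose `i`-th transition from `z` is given by
`stackOp p q · (z + 1) 0` if `i < n`, and by `stackOp p q · z 0` afterwards. -/
structure IsLeftChain {Ω : Type*} [MeasurableSpace Ω] (P : Measure Ω) (p q : ℝ≥0∞) (n : ℕ)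
    (Z : ℕ → Ω → ℕ) : Prop where
  meas : ∀ i, Measurable (Z i)
  zero : ∀ ω, Z 0 ω = 0
  markov : ∀ i (φ : (Fin (i + 1) → ℕ) → ℝ≥0∞) (ψ : ℕ → ℝ≥0∞),
    ∫⁻ ω, φ (hist Z i ω) * ψ (Z (i + 1) ω) ∂P
      = ∫⁻ ω, φ (hist Z i ω) * stackOp p q ψ (Z i ω + if i < n then 1 else 0) 0 ∂P

theorem IsRegularWalk.isLeftChain {Ω : Type*} [MeasurableSpace Ω] {P : Measure Ω}
    [IsProbabilityMeasure P] {p q : ℝ≥0∞} (hpq : p + q = 1) {X : ℕ → Ω → ℤ}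
    (hX : IsRegularWalk P p q X) (n : ℕ) : IsLeftChain P p q n (hX.tally n) := by
  refine ⟨hX.measurable_tally n, hX.tally_zero n, fun i φ ψ => ?_⟩
  set Z := hX.tally n with hZ
  have hm := measurable_hist (hX.measurable_tally n) i
  refine lintegral_congr_of_fiber hm fun ω₀ => ?_
  rw [← hZ]
  set B := hist Z i ⁻¹' {hist Z i ω₀} with hB
  have hBm : MeasurableSet B := hm (measurableSet_singleton _)
  have hprob : P B = ∏ l ∈ Finset.range i,
      stackOp p q (Pi.single (Z (l + 1) ω₀) 1) (Z l ω₀ + if l < n then 1 else 0) 0 := by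
    rw [← hX.prob_tally hpq n i (z := fun l => Z l ω₀) (hX.tally_zero n ω₀)]
    congr 1
    ext ω
    exact hist_eq_iff
  have hnext : ∀ j, P (B ∩ {ω | Z (i + 1) ω = j})
      = P B * stackOp p q (Pi.single j 1) (Z i ω₀ + if i < n then 1 else 0) 0 := by
    intro j
    have := hX.prob_tally hpq n (i + 1) (z := fun l => if l = i + 1 then j else Z l ω₀)
      (by simp [hZ, hX.tally_zero])
    rw [Finset.prod_range_succ] at this
    rw [hprob]
    convert this using 2
    · ext ω
      simp only [hB, Set.mem_inter_iff, Set.mem_preimage, Set.mem_singleton_iff, hist_eq_iff,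
        Set.mem_ofPred_eq]
      constructor
      · rintro ⟨h, h'⟩ l hl
        split_ifs with hl'
        · rw [hl', ← h']
        · exact h l (by omega)
      · intro h
        refine ⟨fun l hl => ?_, ?_⟩
        · have := h l (by omega)
          rwa [if_neg (by omega)] at this
        · simpa using h (i + 1) le_rfl
    · refine Finset.prod_congr rfl fun l hl => ?_
      have := Finset.mem_range.1 hl
      simp only [show ¬ l + 1 = i + 1 by omega, show ¬ l = i + 1 by omega, if_false]
    · simp
  have hjm : ∀ j, MeasurableSet {ω | Z (i + 1) ω = j} := fun j =>
    hX.measurable_tally n (i + 1) (measurableSet_singleton j)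
  have hφ : ∀ ω ∈ B, φ (hist Z i ω) = φ (hist Z i ω₀) := fun ω hω => congrArg φ hω
  have hZi : ∀ ω ∈ B, Z i ω = Z i ω₀ := fun ω hω => hist_eq_iff.1 hω i le_rfl
  calc ∫⁻ ω in B, φ (hist Z i ω) * ψ (Z (i + 1) ω) ∂P
      = ∫⁻ ω in B, φ (hist Z i ω₀) * ψ (Z (i + 1) ω) ∂P :=
        setLIntegral_congr_fun hBm fun ω hω => by simp only [hφ ω hω]
    _ = φ (hist Z i ω₀) * ∫⁻ ω in B, ψ (Z (i + 1) ω) ∂P :=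
        lintegral_const_mul _ ((Measurable.of_discrete (f := ψ)).comp
          (hX.measurable_tally n (i + 1)))
    _ = φ (hist Z i ω₀)
          * ∫⁻ ω in B, ∑' j, {ω | Z (i + 1) ω = j}.indicator (fun _ => ψ j) ω ∂P := by
        congr 1
        refine lintegral_congr fun ω => ?_
        rw [tsum_eq_single (Z (i + 1) ω)]
        · simp
        · intro j hj
          exact Set.indicator_of_notMem (fun h => hj h.symm) _
    _ = φ (hist Z i ω₀) * ∑' j, ψ j * (P B * stackOp p q (Pi.single j 1) (Z i ω₀ + if i < n then 1 else 0) 0) := by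
        rw [lintegral_tsum fun j => (measurable_const.indicator (hjm j)).aemeasurable]
        congr 1
        refine tsum_congr fun j => ?_
        rw [lintegral_indicator_const (hjm j), Measure.restrict_apply (hjm j), Set.inter_comm,
          hnext]
    _ = φ (hist Z i ω₀) * stackOp p q ψ (Z i ω₀ + if i < n then 1 else 0) 0 * P B := by
        rw [stackOp_eq_tsum, mul_assoc, ← ENNReal.tsum_mul_right]
        congr 1
        exact tsum_congr fun j => by ring
    _ = ∫⁻ ω in B, φ (hist Z i ω) * stackOp p q ψ (Z i ω + if i < n then 1 else 0) 0 ∂P := by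
        rw [← setLIntegral_const]
        exact setLIntegral_congr_fun hBm fun ω hω => by simp only [hφ ω hω, hZi ω hω]

theorem cast_choose_three (z : ℕ) : (z.choose 3 : ℝ) = z * (z - 1) * (z - 2) / 6 := by
  induction z with
  | zero => simp
  | succ z ih =>
    rw [Nat.choose_succ_succ, Nat.cast_add, ih, Nat.cast_choose_two]
    push_cast
    ring

theorem cast_choose_four (z : ℕ) : (z.choose 4 : ℝ) = z * (z - 1) * (z - 2) * (z - 3) / 24 := by
  induction z with
  | zero => simp
  | succ z ih =>
    rw [Nat.choose_succ_succ, Nat.cast_add, ih, cast_choose_three]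
    push_cast
    ring

theorem cast_choose_five (z : ℕ) :
    (z.choose 5 : ℝ) = z * (z - 1) * (z - 2) * (z - 3) * (z - 4) / 120 := by
  induction z with
  | zero => simp
  | succ z ih =>
    rw [Nat.choose_succ_succ, Nat.cast_add, ih, cast_choose_four]
    push_cast
    ring

theorem lyap_ofReal {r : ℝ} (hr : 0 ≤ r) (k z : ℕ) :
    lyap (ENNReal.ofReal r) k z = ENNReal.ofReal (z.choose (k + 2) + r * z.choose (k + 1)) := by
  rw [ENNReal.ofReal_add (by positivity) (by positivity), ENNReal.ofReal_mul hr]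
  simp [lyap]

theorem multichoose_add_pow_le {r : ℝ} (hr : 10 ≤ r) (z : ℕ) :
    ((z + 1).multichoose 5 : ℝ) + (z + 1).multichoose 4 + z ^ 4 / 24
      ≤ z.choose 5 + r * z.choose 4 + 10 ^ 6 := by
  rw [Nat.multichoose_eq, Nat.multichoose_eq]
  have h : 10 * (z.choose 4 : ℝ) ≤ r * z.choose 4 := by gcongr
  refine le_trans ?_ (add_le_add_left (add_le_add_right h _) _)
  rw [show z + 1 + 5 - 1 = z + 5 by omega, show z + 1 + 4 - 1 = z + 4 by omega,
    cast_choose_five, cast_choose_five, cast_choose_four, cast_choose_four]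
  have hz : (0 : ℝ) ≤ z := by positivity
  push_cast
  nlinarith [sq_nonneg ((z : ℝ) ^ 2 - 14 * z - 100), sq_nonneg ((z : ℝ) - 20), sq_nonneg (z : ℝ),
    mul_nonneg hz hz]

theorem pow_four_le {r : ℝ} (hr : 10 ≤ r) (z : ℕ) :
    (z : ℝ) ^ 4 ≤ 5 * (z.choose 5 + r * z.choose 4) + 10 ^ 6 := by
  have h : 10 * (z.choose 4 : ℝ) ≤ r * z.choose 4 := by gcongr
  have h5 : (0 : ℝ) ≤ z.choose 5 := by positivity
  have h6 := cast_choose_four z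
  have hz : (0 : ℝ) ≤ z := by positivity
  nlinarith [sq_nonneg ((z : ℝ) ^ 2 - 6 * z - 50), sq_nonneg ((z : ℝ) - 20), sq_nonneg (z : ℝ)]

namespace IsLeftChain

variable {Ω : Type*} [MeasurableSpace Ω] {P : Measure Ω} {p q : ℝ≥0∞} {n : ℕ} {Z : ℕ → Ω → ℕ}

theorem measurable_comp (hZ : IsLeftChain P p q n Z) {γ : Type*} [MeasurableSpace γ] (i : ℕ)
    (ψ : ℕ → γ) : Measurable fun ω => ψ (Z i ω) :=
  (Measurable.of_discrete (f := ψ)).comp (hZ.meas i)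

theorem lintegral_succ (hZ : IsLeftChain P p q n Z) (i : ℕ) (ψ : ℕ → ℝ≥0∞) :
    ∫⁻ ω, ψ (Z (i + 1) ω) ∂P
      = ∫⁻ ω, stackOp p q ψ (Z i ω + if i < n then 1 else 0) 0 ∂P := by
  simpa using hZ.markov i (fun _ => 1) ψ

/-- The expected total number of left jumps from negative sites is small. -/
theorem lintegral_tsum_tail_le {r : ℝ} (hZ : IsLeftChain P p q n Z) (hpq : p + q = 1)
    (hqr : q * ENNReal.ofReal r = p) (hr : 10 ≤ r) :
    ∫⁻ ω, ∑' j, (Z (n + j) ω : ℝ≥0∞) ∂P ≤ ∫⁻ ω, lyap (ENNReal.ofReal r) 0 (Z n ω) ∂P := by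
  rw [lintegral_tsum fun j => (hZ.measurable_comp (n + j) fun z => (z : ℝ≥0∞)).aemeasurable]
  refine ENNReal.tsum_le_of_sum_range_le fun J => ?_
  suffices h : ∑ j ∈ Finset.range J, ∫⁻ ω, (Z (n + j) ω : ℝ≥0∞) ∂P
      + ∫⁻ ω, lyap (ENNReal.ofReal r) 0 (Z (n + J) ω) ∂P
      ≤ ∫⁻ ω, lyap (ENNReal.ofReal r) 0 (Z n ω) ∂P from le_self_add.trans h
  induction J with
  | zero => simp
  | succ J ih =>
    refine le_trans ?_ ih
    rw [Finset.sum_range_succ, add_assoc, ← add_assoc n]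
    gcongr
    rw [hZ.lintegral_succ _ (lyap (ENNReal.ofReal r) 0), if_neg (by omega),
      ← lintegral_add_left (hZ.measurable_comp (n + J) fun z => (z : ℝ≥0∞))]
    refine lintegral_mono fun ω => ?_
    simp only [stackOp_lyap hpq hqr, add_zero, zero_add]
    rw [lyap_ofReal (by linarith)]
    set z := Z (n + J) ω
    have h1 : ((z.multichoose 2 : ℕ) : ℝ) = z.choose 2 + z := by
      rw [Nat.multichoose_eq, show z + 2 - 1 = z + 1 by omega, Nat.choose_succ_succ]
      push_cast [Nat.choose_one_right]
      ring
    have h2 : (z : ℝ) + (z.multichoose 2 + z.multichoose 1)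
        ≤ z.choose (0 + 2) + r * z.choose (0 + 1) := by
      rw [h1, Nat.multichoose_one_right]
      simp only [zero_add, Nat.choose_one_right]
      nlinarith [show (0 : ℝ) ≤ z by positivity]
    have := ENNReal.ofReal_le_ofReal h2
    rw [ENNReal.ofReal_add (by positivity) (by positivity),
      ENNReal.ofReal_add (by positivity) (by positivity)] at this
    simpa using this

variable [IsProbabilityMeasure P] {r : ℝ}

theorem lintegral_lyap_three_add_sum_le (hZ : IsLeftChain P p q n Z) (hpq : p + q = 1)
    (hqr : q * ENNReal.ofReal r = p) (hr : 10 ≤ r) {k : ℕ} (hk : k ≤ n) :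
    ∫⁻ ω, lyap (ENNReal.ofReal r) 3 (Z k ω) ∂P
      + ∑ i ∈ Finset.range k, ∫⁻ ω, ENNReal.ofReal ((Z i ω : ℝ) ^ 4 / 24) ∂P
      ≤ 10 ^ 6 * k := by
  induction k with
  | zero => simp [hZ.zero, lyap]
  | succ k ih =>
    have step : ∫⁻ ω, lyap (ENNReal.ofReal r) 3 (Z (k + 1) ω) ∂P
        + ∫⁻ ω, ENNReal.ofReal ((Z k ω : ℝ) ^ 4 / 24) ∂P
        ≤ ∫⁻ ω, lyap (ENNReal.ofReal r) 3 (Z k ω) ∂P + 10 ^ 6 := by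
      rw [hZ.lintegral_succ k (lyap (ENNReal.ofReal r) 3), if_pos (by omega),
        ← lintegral_add_right _ (hZ.measurable_comp k fun z => ENNReal.ofReal ((z : ℝ) ^ 4 / 24))]
      have hc : (10 ^ 6 : ℝ≥0∞) = ∫⁻ _, 10 ^ 6 ∂P := by simp
      rw [hc, ← lintegral_add_right _ measurable_const]
      refine lintegral_mono fun ω => ?_
      simp only [stackOp_lyap hpq hqr]
      rw [lyap_ofReal (by linarith)]
      have := ENNReal.ofReal_le_ofReal (multichoose_add_pow_le hr (Z k ω))
      rw [ENNReal.ofReal_add (by positivity) (by positivity),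
        ENNReal.ofReal_add (by positivity) (by positivity),
        ENNReal.ofReal_add (by positivity) (by positivity)] at this
      simpa using this
    rw [Finset.sum_range_succ]
    calc _ = (∫⁻ ω, lyap (ENNReal.ofReal r) 3 (Z (k + 1) ω) ∂P
            + ∫⁻ ω, ENNReal.ofReal ((Z k ω : ℝ) ^ 4 / 24) ∂P)
          + ∑ i ∈ Finset.range k, ∫⁻ ω, ENNReal.ofReal ((Z i ω : ℝ) ^ 4 / 24) ∂P := by ring
      _ ≤ (∫⁻ ω, lyap (ENNReal.ofReal r) 3 (Z k ω) ∂P + 10 ^ 6)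
          + ∑ i ∈ Finset.range k, ∫⁻ ω, ENNReal.ofReal ((Z i ω : ℝ) ^ 4 / 24) ∂P := by gcongr
      _ = (∫⁻ ω, lyap (ENNReal.ofReal r) 3 (Z k ω) ∂P
          + ∑ i ∈ Finset.range k, ∫⁻ ω, ENNReal.ofReal ((Z i ω : ℝ) ^ 4 / 24) ∂P) + 10 ^ 6 := by ring
      _ ≤ 10 ^ 6 * k + 10 ^ 6 := by gcongr; exact ih (by omega)
      _ = _ := by push_cast; ring

theorem sum_lintegral_pow_four_le (hZ : IsLeftChain P p q n Z) (hpq : p + q = 1)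
    (hqr : q * ENNReal.ofReal r = p) (hr : 10 ≤ r) (hn : 1 ≤ n) :
    ∑ i ∈ Finset.range (n + 1), ∫⁻ ω, ENNReal.ofReal ((Z i ω : ℝ) ^ 4) ∂P ≤ 10 ^ 8 * n := by
  have h := hZ.lintegral_lyap_three_add_sum_le hpq hqr hr le_rfl
  have h1 : ∑ i ∈ Finset.range n, ∫⁻ ω, ENNReal.ofReal ((Z i ω : ℝ) ^ 4) ∂P
      ≤ 24 * (10 ^ 6 * n) := by
    calc _ = 24 * ∑ i ∈ Finset.range n, ∫⁻ ω, ENNReal.ofReal ((Z i ω : ℝ) ^ 4 / 24) ∂P := by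
          rw [Finset.mul_sum]
          refine Finset.sum_congr rfl fun i _ => ?_
          rw [← lintegral_const_mul _ (hZ.measurable_comp i fun z => ENNReal.ofReal ((z : ℝ) ^ 4 / 24))]
          refine lintegral_congr fun ω => ?_
          rw [show (24 : ℝ≥0∞) = ENNReal.ofReal 24 by simp, ← ENNReal.ofReal_mul (by norm_num)]
          congr 1
          ring
      _ ≤ _ := by gcongr; exact le_add_self.trans h
  have h2 : ∫⁻ ω, ENNReal.ofReal ((Z n ω : ℝ) ^ 4) ∂P ≤ 5 * (10 ^ 6 * n) + 10 ^ 6 := by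
    calc _ ≤ ∫⁻ ω, (5 * lyap (ENNReal.ofReal r) 3 (Z n ω) + 10 ^ 6) ∂P := by
          refine lintegral_mono fun ω => ?_
          rw [lyap_ofReal (by linarith)]
          have := ENNReal.ofReal_le_ofReal (pow_four_le hr (Z n ω))
          rw [ENNReal.ofReal_add (by positivity) (by positivity),
            ENNReal.ofReal_mul (by norm_num)] at this
          simpa using this
      _ = 5 * ∫⁻ ω, lyap (ENNReal.ofReal r) 3 (Z n ω) ∂P + 10 ^ 6 := by
          rw [lintegral_add_right _ measurable_const,
            lintegral_const_mul _ (hZ.measurable_comp n _)]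
          simp
      _ ≤ _ := by gcongr; exact le_self_add.trans h
  rw [Finset.sum_range_succ]
  calc _ ≤ 24 * (10 ^ 6 * (n : ℝ≥0∞)) + (5 * (10 ^ 6 * n) + 10 ^ 6 * n) := by
        refine add_le_add h1 (h2.trans ?_)
        gcongr
        exact le_mul_of_one_le_right' (by exact_mod_cast hn)
    _ = (30 * 10 ^ 6) * n := by ring
    _ ≤ _ := by gcongr; norm_num

end IsLeftChain

theorem integral_sub_const_mul_sub_eq_zero {Ω : Type*} [MeasurableSpace Ω] {P : Measure Ω}
    [IsFiniteMeasure P] {A F G : Ω → ℝ} (hA : MemLp A 2 P) (hF : MemLp F 2 P) (hG : MemLp G 2 P)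
    (hAFG : ∫ ω, A ω * F ω ∂P = ∫ ω, A ω * G ω ∂P) (hFG : ∫ ω, F ω ∂P = ∫ ω, G ω ∂P) (c : ℝ) :
    ∫ ω, (A ω - c) * (F ω - G ω) ∂P = 0 := by
  have i1 : Integrable (fun ω => A ω * F ω) P := hA.integrable_mul hF
  have i2 : Integrable (fun ω => A ω * G ω) P := hA.integrable_mul hG
  have i3 := hF.integrable one_le_two
  have i4 := hG.integrable one_le_two
  have i5 : Integrable (fun ω => A ω * F ω - A ω * G ω) P := i1.sub i2
  have i6 : Integrable (fun ω => c * (F ω - G ω)) P := (i3.sub i4).const_mul c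
  calc _ = ∫ ω, (A ω * F ω - A ω * G ω) - c * (F ω - G ω) ∂P := by
        refine integral_congr_ae (Eventually.of_forall fun ω => ?_)
        ring
    _ = 0 := by
        rw [integral_sub i5 i6, integral_sub i1 i2, integral_const_mul, integral_sub i3 i4, hAFG,
          hFG]
        ring

namespace IsLeftChain

variable {Ω : Type*} [MeasurableSpace Ω] {P : Measure Ω} {p q : ℝ≥0∞} {n : ℕ} {Z : ℕ → Ω → ℕ}
  {r : ℝ}

theorem integral_mul_succ (hZ : IsLeftChain P p q n Z) (hpq : p + q = 1)
    (hqr : q * ENNReal.ofReal r = p) (hr : 0 ≤ r) {k : ℕ} (hk : k < n)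
    {φ : (Fin (k + 1) → ℕ) → ℝ} (hφ : ∀ z, 0 ≤ φ z) :
    ∫ ω, φ (hist Z k ω) * ((Z (k + 1) ω).choose 2 + r * Z (k + 1) ω) ∂P
      = ∫ ω, φ (hist Z k ω) * ((Z k ω + 1).multichoose 2 + (Z k ω + 1)) ∂P := by
  have hm : Measurable fun ω => φ (hist Z k ω) :=
    (measurable_of_countable φ).comp (measurable_hist hZ.meas k)
  have h1 : Measurable fun ω => ((Z (k + 1) ω).choose 2 + r * Z (k + 1) ω : ℝ) :=
    hZ.measurable_comp (k + 1) fun z => (z.choose 2 + r * z : ℝ)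
  have h2 : Measurable fun ω => ((Z k ω + 1).multichoose 2 + (Z k ω + 1) : ℝ) :=
    hZ.measurable_comp k fun z => ((z + 1).multichoose 2 + (z + 1) : ℝ)
  rw [integral_eq_lintegral_of_nonneg_ae, integral_eq_lintegral_of_nonneg_ae]
  · congr 1
    have := hZ.markov k (fun z => ENNReal.ofReal (φ z)) (lyap (ENNReal.ofReal r) 0)
    simp only [stackOp_lyap hpq hqr, lyap_ofReal hr, if_pos hk] at this
    calc _ = _ := lintegral_congr fun ω => ?_
      _ = _ := this
      _ = _ := lintegral_congr fun ω => ?_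
    · rw [ENNReal.ofReal_mul (hφ _)]
      simp
    · rw [ENNReal.ofReal_mul (hφ _), ENNReal.ofReal_add (by positivity) (by positivity),
        ENNReal.ofReal_natCast, ← Nat.cast_add_one, ENNReal.ofReal_natCast]
      simp
  · exact Eventually.of_forall fun ω => mul_nonneg (hφ _) (by positivity)
  · exact (hm.mul h2).aestronglyMeasurable
  · exact Eventually.of_forall fun ω => mul_nonneg (hφ _) (by positivity)
  · exact (hm.mul h1).aestronglyMeasurable

theorem cast_multichoose_two (z : ℕ) :
    ((z + 1).multichoose 2 : ℝ) = (z + 1) * (z + 2) / 2 := by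
  rw [Nat.multichoose_eq, show z + 1 + 2 - 1 = z + 2 by omega, Nat.cast_choose_two]
  push_cast
  ring

variable [IsProbabilityMeasure P]

theorem integrable_pow_four (hZ : IsLeftChain P p q n Z) (hpq : p + q = 1)
    (hqr : q * ENNReal.ofReal r = p) (hr : 10 ≤ r) (hn : 1 ≤ n) {i : ℕ} (hi : i ≤ n) :
    Integrable (fun ω => (Z i ω : ℝ) ^ 4) P := by
  refine ⟨(hZ.measurable_comp i fun z => (z : ℝ) ^ 4).aestronglyMeasurable, ?_⟩
  rw [hasFiniteIntegral_iff_ofReal (Eventually.of_forall fun ω => by positivity)]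
  calc _ ≤ _ := Finset.single_le_sum (s := Finset.range (n + 1))
        (f := fun i => ∫⁻ ω, ENNReal.ofReal ((Z i ω : ℝ) ^ 4) ∂P) (fun _ _ => zero_le)
        (Finset.mem_range.2 (by omega))
    _ ≤ _ := hZ.sum_lintegral_pow_four_le hpq hqr hr hn
    _ < ⊤ := by
      refine ENNReal.mul_lt_top ?_ (by simp)
      exact ENNReal.pow_lt_top (by simp)

theorem sum_integral_pow_four_le (hZ : IsLeftChain P p q n Z) (hpq : p + q = 1)
    (hqr : q * ENNReal.ofReal r = p) (hr : 10 ≤ r) (hn : 1 ≤ n) :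
    ∑ i ∈ Finset.range (n + 1), ∫ ω, (Z i ω : ℝ) ^ 4 ∂P ≤ 10 ^ 8 * n := by
  have h := hZ.sum_lintegral_pow_four_le hpq hqr hr hn
  have : ∀ i ∈ Finset.range (n + 1), ∫⁻ ω, ENNReal.ofReal ((Z i ω : ℝ) ^ 4) ∂P
      = ENNReal.ofReal (∫ ω, (Z i ω : ℝ) ^ 4 ∂P) := fun i hi =>
    (ofReal_integral_eq_lintegral_ofReal
      (hZ.integrable_pow_four hpq hqr hr hn (by simpa [Nat.lt_succ_iff] using hi))
      (Eventually.of_forall fun ω => by positivity)).symm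
  rw [Finset.sum_congr rfl this, ← ENNReal.ofReal_sum_of_nonneg fun i _ => by positivity] at h
  rw [← ENNReal.ofReal_le_ofReal_iff (by positivity), ENNReal.ofReal_mul (by positivity)]
  simpa using h

theorem memLp_sq (hZ : IsLeftChain P p q n Z) (hpq : p + q = 1)
    (hqr : q * ENNReal.ofReal r = p) (hr : 10 ≤ r) (hn : 1 ≤ n) {i : ℕ} (hi : i ≤ n) :
    MemLp (fun ω => (Z i ω : ℝ) ^ 2) 2 P := by
  rw [memLp_two_iff_integrable_sq (hZ.measurable_comp i fun z => (z : ℝ) ^ 2).aestronglyMeasurable]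
  refine (hZ.integrable_pow_four hpq hqr hr hn hi).congr (Eventually.of_forall fun ω => ?_)
  ring

theorem memLp_two (hZ : IsLeftChain P p q n Z) (hpq : p + q = 1)
    (hqr : q * ENNReal.ofReal r = p) (hr : 10 ≤ r) (hn : 1 ≤ n) {i : ℕ} (hi : i ≤ n) :
    MemLp (fun ω => (Z i ω : ℝ)) 2 P := by
  refine (hZ.memLp_sq hpq hqr hr hn hi).mono'
    (hZ.measurable_comp i fun z => (z : ℝ)).aestronglyMeasurable (Eventually.of_forall fun ω => ?_)
  rw [Real.norm_eq_abs, abs_of_nonneg (by positivity)]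
  exact_mod_cast Nat.le_self_pow two_ne_zero _

theorem memLp_lyap (hZ : IsLeftChain P p q n Z) (hpq : p + q = 1)
    (hqr : q * ENNReal.ofReal r = p) (hr : 10 ≤ r) (hn : 1 ≤ n) {i : ℕ} (hi : i ≤ n) :
    MemLp (fun ω => ((Z i ω).choose 2 + r * Z i ω : ℝ)) 2 P := by
  have := ((hZ.memLp_sq hpq hqr hr hn hi).const_mul (1 / 2)).add
    ((hZ.memLp_two hpq hqr hr hn hi).const_mul (r - 1 / 2))
  convert this using 2 with ω
  simp only [Nat.cast_choose_two, Pi.add_apply]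
  ring

theorem choose_two_add_le (hr : 10 ≤ r) (z : ℕ) : (z.choose 2 + r * z : ℝ) ≤ r * z ^ 2 := by
  have h : (z : ℝ) ≤ z ^ 2 := by exact_mod_cast Nat.le_self_pow two_ne_zero _
  rw [Nat.cast_choose_two]
  nlinarith

theorem sq_choose_two_add_le (hr : 10 ≤ r) (z : ℕ) :
    (z.choose 2 + r * z : ℝ) ^ 2 ≤ r ^ 2 * z ^ 4 := by
  calc _ ≤ (r * z ^ 2 : ℝ) ^ 2 := pow_le_pow_left₀ (by positivity) (choose_two_add_le hr z) 2
    _ = _ := by ring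

theorem increment_sq_le (hr : 10 ≤ r) (z z' : ℕ) :
    (z'.choose 2 + r * z' - ((z + 1).multichoose 2 + (z + 1)) : ℝ) ^ 2
      ≤ 2 * r ^ 2 * z' ^ 4 + 36 * z ^ 4 + 16 := by
  have h1 := sq_choose_two_add_le hr z'
  have h : (z : ℝ) ≤ z ^ 2 := by exact_mod_cast Nat.le_self_pow two_ne_zero _
  have h2 : ((z + 1).multichoose 2 + (z + 1) : ℝ) ^ 2 ≤ (3 * z ^ 2 + 2) ^ 2 := by
    refine pow_le_pow_left₀ (by positivity) ?_ 2
    rw [cast_multichoose_two]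
    nlinarith
  nlinarith [sq_nonneg ((z'.choose 2 + r * z' : ℝ) + ((z + 1).multichoose 2 + (z + 1))),
    sq_nonneg ((3 * z ^ 2 : ℝ) - 2)]

/-- The martingale part of the Lyapunov function of the chain. -/
def compensated (r : ℝ) (Z : ℕ → Ω → ℕ) (k : ℕ) (ω : Ω) : ℝ :=
  (Z k ω).choose 2 + r * Z k ω + (r - 3) * ∑ i ∈ Finset.range k, (Z i ω : ℝ) - 2 * k

theorem integral_compensated_sq_le (hZ : IsLeftChain P p q n Z) (hpq : p + q = 1)
    (hqr : q * ENNReal.ofReal r = p) (hr : 10 ≤ r) (hn : 1 ≤ n) {k : ℕ} (hk : k ≤ n) :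
    MemLp (compensated r Z k) 2 P ∧ ∫ ω, compensated r Z k ω ^ 2 ∂P
      ≤ ∑ i ∈ Finset.range k, ∫ ω, (2 * r ^ 2 * (Z (i + 1) ω : ℝ) ^ 4 + 36 * (Z i ω : ℝ) ^ 4 + 16) ∂P := by
  have hdrift : ∀ k ≤ n,
      MemLp (fun ω => (Z k ω).choose 2 + r * Z k ω + (r - 3) * ∑ i ∈ Finset.range k, (Z i ω : ℝ))
        2 P := fun k hk => (hZ.memLp_lyap hpq hqr hr hn hk).add <|
      (memLp_finsetSum _ fun i hi =>
        hZ.memLp_two hpq hqr hr hn (by have := Finset.mem_range.1 hi; omega)).const_mul (r - 3)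
  have hmem : ∀ k ≤ n, MemLp (compensated r Z k) 2 P := fun k hk =>
    (hdrift k hk).sub (memLp_const (2 * k : ℝ))
  refine ⟨hmem k hk, ?_⟩
  induction k with
  | zero => simp [compensated, hZ.zero]
  | succ k ih =>
    set D : Ω → ℝ := fun ω => (Z (k + 1) ω).choose 2 + r * Z (k + 1) ω
      - ((Z k ω + 1).multichoose 2 + (Z k ω + 1)) with hD
    have hgmem : MemLp (fun ω => ((Z k ω + 1).multichoose 2 + (Z k ω + 1) : ℝ)) 2 P := by
      convert (((hZ.memLp_sq hpq hqr hr hn (by omega : k ≤ n)).const_mul (1 / 2)).add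
        ((hZ.memLp_two hpq hqr hr hn (by omega : k ≤ n)).const_mul (5 / 2))).add
        (memLp_const (2 : ℝ)) using 2 with ω
      simp only [cast_multichoose_two, Pi.add_apply]
      ring
    have hDmem : MemLp D 2 P := (hZ.memLp_lyap hpq hqr hr hn hk).sub hgmem
    have hstep : ∀ ω, compensated r Z (k + 1) ω = compensated r Z k ω + D ω := by
      intro ω
      simp only [compensated, hD, Finset.sum_range_succ, cast_multichoose_two, Nat.cast_choose_two]
      push_cast
      ring
    have horth : ∫ ω, compensated r Z k ω * D ω ∂P = 0 := by
      have e1 := hZ.integral_mul_succ hpq hqr (by linarith) (k := k) (by omega)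
        (φ := fun z => (z (Fin.last k)).choose 2 + r * z (Fin.last k)
          + (r - 3) * ∑ i : Fin k, (z i.castSucc : ℝ)) (fun z => by
            have : 0 ≤ r - 3 := by linarith
            positivity)
      have e2 := hZ.integral_mul_succ hpq hqr (by linarith) (k := k) (by omega)
        (φ := fun _ => 1) (fun _ => zero_le_one)
      simp only [hist, Fin.val_last, Fin.val_castSucc, one_mul] at e1 e2
      have hA := hdrift k (by omega)
      have hf := hZ.memLp_lyap hpq hqr hr hn hk
      have := integral_sub_const_mul_sub_eq_zero hA hf hgmem ?_ e2 (2 * k)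
      · simpa only [compensated, hD] using this
      · convert e1 using 5
        all_goals rw [Finset.sum_range]
    have hM := hmem k (by omega)
    have iM := hM.integrable_sq
    have iMD : Integrable (fun ω => compensated r Z k ω * D ω) P := hM.integrable_mul hDmem
    have iD := hDmem.integrable_sq
    have hsq : ∫ ω, compensated r Z (k + 1) ω ^ 2 ∂P
        = ∫ ω, compensated r Z k ω ^ 2 ∂P + ∫ ω, D ω ^ 2 ∂P := by
      calc _ = ∫ ω, (compensated r Z k ω ^ 2 + 2 * (compensated r Z k ω * D ω)) + D ω ^ 2 ∂P := by
            refine integral_congr_ae (Eventually.of_forall fun ω => ?_)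
            simp only [hstep]
            ring
        _ = _ := by
            have i1 : Integrable
                (fun ω => compensated r Z k ω ^ 2 + 2 * (compensated r Z k ω * D ω)) P :=
              iM.add (iMD.const_mul 2)
            rw [integral_add i1 iD, integral_add iM (iMD.const_mul 2),
              integral_const_mul, horth]
            ring
    rw [hsq, Finset.sum_range_succ]
    refine add_le_add (ih (by omega)) (integral_mono iD ?_ fun ω => increment_sq_le hr _ _)
    exact (((hZ.integrable_pow_four hpq hqr hr hn hk).const_mul _).add
      ((hZ.integrable_pow_four hpq hqr hr hn (by omega)).const_mul _)).add (integrable_const _)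

theorem lintegral_sum_sub_sq_le (hZ : IsLeftChain P p q n Z) (hpq : p + q = 1)
    (hqr : q * ENNReal.ofReal r = p) (hr : 10 ≤ r) (hn : 1 ≤ n) :
    ∫⁻ ω, ENNReal.ofReal (((r - 3) * ∑ i ∈ Finset.range n, (Z i ω : ℝ) - 2 * n) ^ 2) ∂P
      ≤ ENNReal.ofReal (10 ^ 9 * r ^ 2 * n) := by
  obtain ⟨hmem, hle⟩ := hZ.integral_compensated_sq_le hpq hqr hr hn le_rfl
  have hS := hZ.sum_integral_pow_four_le hpq hqr hr hn
  have hi := fun {i} => hZ.integrable_pow_four hpq hqr hr hn (i := i)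
  have h1 : ∑ i ∈ Finset.range n, ∫ ω, (2 * r ^ 2 * (Z (i + 1) ω : ℝ) ^ 4
      + 36 * (Z i ω : ℝ) ^ 4 + 16) ∂P ≤ 2 * r ^ 2 * (10 ^ 8 * n) + 36 * (10 ^ 8 * n) + 16 * n := by
    have : ∀ i ∈ Finset.range n, ∫ ω, (2 * r ^ 2 * (Z (i + 1) ω : ℝ) ^ 4
        + 36 * (Z i ω : ℝ) ^ 4 + 16) ∂P = 2 * r ^ 2 * ∫ ω, (Z (i + 1) ω : ℝ) ^ 4 ∂P
          + 36 * ∫ ω, (Z i ω : ℝ) ^ 4 ∂P + 16 := by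
      intro i hin
      have hin := Finset.mem_range.1 hin
      have a1 := (hi (i := i + 1) (by omega)).const_mul (2 * r ^ 2)
      have a2 := (hi (i := i) (by omega)).const_mul 36
      have a3 : Integrable
          (fun ω => 2 * r ^ 2 * (Z (i + 1) ω : ℝ) ^ 4 + 36 * (Z i ω : ℝ) ^ 4) P := a1.add a2
      rw [integral_add a3 (integrable_const _), integral_add a1 a2, integral_const_mul,
        integral_const_mul]
      simp
    rw [Finset.sum_congr rfl this, Finset.sum_add_distrib, Finset.sum_add_distrib,
      ← Finset.mul_sum, ← Finset.mul_sum]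
    have b1 : ∑ i ∈ Finset.range n, ∫ ω, (Z (i + 1) ω : ℝ) ^ 4 ∂P ≤ 10 ^ 8 * n := by
      rw [Finset.sum_range_succ'] at hS
      have : 0 ≤ ∫ ω, (Z 0 ω : ℝ) ^ 4 ∂P := by positivity
      linarith
    have b2 : ∑ i ∈ Finset.range n, ∫ ω, (Z i ω : ℝ) ^ 4 ∂P ≤ 10 ^ 8 * n := by
      rw [Finset.sum_range_succ] at hS
      have : 0 ≤ ∫ ω, (Z n ω : ℝ) ^ 4 ∂P := by positivity
      linarith
    gcongr
    simp [mul_comm]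
  have h2 : ∫ ω, (Z n ω : ℝ) ^ 4 ∂P ≤ 10 ^ 8 * n :=
    (Finset.single_le_sum (f := fun i => ∫ ω, (Z i ω : ℝ) ^ 4 ∂P) (fun i _ => by positivity)
      (Finset.mem_range.2 (Nat.lt_succ_self n))).trans hS
  have hint : Integrable (fun ω => 2 * compensated r Z n ω ^ 2 + 2 * (r ^ 2 * (Z n ω : ℝ) ^ 4)) P :=
    (hmem.integrable_sq.const_mul 2).add (((hi le_rfl).const_mul _).const_mul 2)
  calc _ ≤ ∫⁻ ω, ENNReal.ofReal (2 * compensated r Z n ω ^ 2 + 2 * (r ^ 2 * (Z n ω : ℝ) ^ 4)) ∂P := by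
        refine lintegral_mono fun ω => ENNReal.ofReal_le_ofReal ?_
        have := sq_choose_two_add_le hr (Z n ω)
        have e : (r - 3) * ∑ i ∈ Finset.range n, (Z i ω : ℝ) - 2 * n
            = compensated r Z n ω - ((Z n ω).choose 2 + r * Z n ω) := by
          simp only [compensated]; ring
        rw [e]
        nlinarith [sq_nonneg (compensated r Z n ω + ((Z n ω).choose 2 + r * Z n ω))]
    _ = ENNReal.ofReal (∫ ω, (2 * compensated r Z n ω ^ 2 + 2 * (r ^ 2 * (Z n ω : ℝ) ^ 4)) ∂P) :=
        (ofReal_integral_eq_lintegral_ofReal hint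
          (Eventually.of_forall fun ω => by positivity)).symm
    _ ≤ _ := by
        refine ENNReal.ofReal_le_ofReal ?_
        rw [integral_add (hmem.integrable_sq.const_mul 2) (((hi le_rfl).const_mul _).const_mul 2),
          integral_const_mul, integral_const_mul, integral_const_mul]
        have hr2 : 100 ≤ r ^ 2 := by nlinarith
        have hn0 : (0 : ℝ) ≤ n := by positivity
        have h3 := mul_le_mul_of_nonneg_left h2 (show 0 ≤ r ^ 2 by positivity)
        nlinarith [mul_le_mul_of_nonneg_right hr2 hn0]

theorem lintegral_tsum_tail_le_sqrt (hZ : IsLeftChain P p q n Z) (hpq : p + q = 1)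
    (hqr : q * ENNReal.ofReal r = p) (hr : 10 ≤ r) {s : ℕ} (hs : 1 ≤ s) (hn : n = s ^ 2) :
    ∫⁻ ω, ∑' j, (Z (n + j) ω : ℝ≥0∞) ∂P ≤ ENNReal.ofReal (10 ^ 9 * r * s) := by
  have hn1 : 1 ≤ n := hn ▸ Nat.one_le_pow _ _ hs
  have hS := hZ.sum_integral_pow_four_le hpq hqr hr hn1
  have h2 : ∫ ω, (Z n ω : ℝ) ^ 4 ∂P ≤ 10 ^ 8 * n :=
    (Finset.single_le_sum (f := fun i => ∫ ω, (Z i ω : ℝ) ^ 4 ∂P) (fun i _ => by positivity)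
      (Finset.mem_range.2 (Nat.lt_succ_self n))).trans hS
  have hi := hZ.integrable_pow_four hpq hqr hr hn1 le_rfl
  have hs0 : (1 : ℝ) ≤ s := by exact_mod_cast hs
  have hint : Integrable (fun ω => r * (s + (s : ℝ)⁻¹ * (Z n ω : ℝ) ^ 4)) P :=
    ((integrable_const _).add (hi.const_mul _)).const_mul _
  calc _ ≤ _ := hZ.lintegral_tsum_tail_le hpq hqr hr
    _ ≤ ∫⁻ ω, ENNReal.ofReal (r * (s + (s : ℝ)⁻¹ * (Z n ω : ℝ) ^ 4)) ∂P := by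
        refine lintegral_mono fun ω => ?_
        rw [lyap_ofReal (by linarith)]
        refine ENNReal.ofReal_le_ofReal ?_
        have h := choose_two_add_le hr (Z n ω)
        simp only [zero_add, Nat.choose_one_right]
        refine h.trans ?_
        gcongr
        have : ((Z n ω : ℝ) ^ 2 - s) ^ 2 * (s : ℝ)⁻¹
            = s + (s : ℝ)⁻¹ * (Z n ω : ℝ) ^ 4 - 2 * (Z n ω : ℝ) ^ 2 := by
          field_simp
          ring
        have h0 : 0 ≤ ((Z n ω : ℝ) ^ 2 - s) ^ 2 * (s : ℝ)⁻¹ := by positivity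
        nlinarith [sq_nonneg (Z n ω : ℝ)]
    _ = ENNReal.ofReal (∫ ω, r * (s + (s : ℝ)⁻¹ * (Z n ω : ℝ) ^ 4) ∂P) :=
        (ofReal_integral_eq_lintegral_ofReal hint
          (Eventually.of_forall fun ω => by positivity)).symm
    _ ≤ _ := by
        refine ENNReal.ofReal_le_ofReal ?_
        rw [integral_const_mul, integral_add (integrable_const _) (hi.const_mul _),
          integral_const_mul]
        have h4 : (s : ℝ)⁻¹ * ∫ ω, (Z n ω : ℝ) ^ 4 ∂P ≤ 10 ^ 8 * s := by
          calc _ ≤ (s : ℝ)⁻¹ * (10 ^ 8 * n) := by gcongr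
            _ = _ := by rw [hn]; push_cast; field_simp
        simp only [integral_const, probReal_univ, one_smul]
        nlinarith

end IsLeftChain

theorem le_hitNat {x : ℕ → ℤ} (hp : IsPath x) (hx : ∀ n : ℕ, ∃ k, (n : ℤ) ≤ x k) (n : ℕ) :
    n ≤ hitNat x hx n := by
  have h : ∀ k : ℕ, x k ≤ k := by
    intro k
    induction k with
    | zero => simp [hp.zero]
    | succ k ih => rcases hp.step k with h | h <;> omega
  have := h (hitNat x hx n)
  rw [hp.apply_hitNat hx] at this
  exact_mod_cast this

theorem IsPath.sub_le {x : ℕ → ℤ} (hp : IsPath x) {j k : ℕ} (h : j ≤ k) :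
    x j - (k - j) ≤ x k := by
  induction k, h using Nat.le_induction with
  | base => simp
  | succ k _ ih =>
    push_cast
    rcases hp.step k with h | h <;> omega

/-- If the hitting times of the fourth powers grow linearly, then so does the path. -/
theorem IsPath.tendsto_div {x : ℕ → ℤ} (hp : IsPath x) (hx : ∀ n : ℕ, ∃ k, (n : ℤ) ≤ x k) {c : ℝ}
    (hc : 0 < c)
    (h : Tendsto (fun k : ℕ => (hitNat x hx (k ^ 4) : ℝ) / (k : ℝ) ^ 4) atTop (𝓝 c)) :
    Tendsto (fun m : ℕ => (x m : ℝ) / m) atTop (𝓝 c⁻¹) := by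
  set T : ℕ → ℕ := fun k => hitNat x hx (k ^ 4) with hT
  have hTle : ∀ k, k ^ 4 ≤ T k := fun k => le_hitNat hp hx _
  have hkT : ∀ k, k ≤ T k := fun k => (Nat.le_self_pow four_ne_zero k).trans (hTle k)
  have hxT : ∀ k, x (T k) = (k : ℤ) ^ 4 := fun k => by
    rw [hp.apply_hitNat hx (k ^ 4), Nat.cast_pow]
  set κ : ℕ → ℕ := fun m => Nat.findGreatest (fun k => T k ≤ m) m with hκ
  have hT0 : T 0 = 0 := by
    by_contra h0
    have := lt_of_lt_hitNat hx (n := 0 ^ 4) (j := 0) (Nat.pos_of_ne_zero h0)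
    simp [hp.zero] at this
  have hκle : ∀ m, T (κ m) ≤ m := fun m =>
    Nat.findGreatest_spec (P := fun k => T k ≤ m) (Nat.zero_le m) (by simp [hT0])
  have hκlt : ∀ m, m < T (κ m + 1) := fun m => by
    rcases le_or_gt (κ m + 1) m with h1 | h1
    · exact not_le.1 (Nat.findGreatest_is_greatest (P := fun k => T k ≤ m) (Nat.lt_succ_self _) h1)
    · exact h1.trans_le (hkT _)
  have hκtop : Tendsto κ atTop atTop := by
    refine tendsto_atTop.2 fun K => ?_
    filter_upwards [eventually_ge_atTop (T K)] with m hm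
    exact Nat.le_findGreatest ((hkT K).trans hm) hm
  set ρ : ℕ → ℝ := fun k => ((k + 1 : ℕ) : ℝ) ^ 4 / (k : ℝ) ^ 4 with hρ
  have hρ1 : Tendsto ρ atTop (𝓝 1) := by
    have h1 : Tendsto (fun k : ℕ => (1 + 1 / (k : ℝ)) ^ 4) atTop (𝓝 ((1 + 0) ^ 4)) :=
      (tendsto_const_nhds.add tendsto_one_div_atTop_nhds_zero_nat).pow 4
    rw [add_zero, one_pow] at h1
    refine h1.congr' ?_
    filter_upwards [eventually_gt_atTop 0] with k hk
    have : (0 : ℝ) < k := by exact_mod_cast hk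
    simp only [hρ]
    rw [← div_pow]
    congr 1
    push_cast
    field_simp
  have h' : Tendsto (fun k : ℕ => (T (k + 1) : ℝ) / ((k + 1 : ℕ) : ℝ) ^ 4) atTop (𝓝 c) :=
    (tendsto_add_atTop_iff_nat 1).2 h
  have hup : Tendsto (fun k : ℕ => ((k + 1 : ℕ) : ℝ) ^ 4 / (T k : ℝ)) atTop (𝓝 c⁻¹) := by
    have := hρ1.mul (h.inv₀ hc.ne')
    rw [one_mul] at this
    refine this.congr' ?_
    filter_upwards [eventually_gt_atTop 0] with k hk
    have : (0 : ℝ) < k := by exact_mod_cast hk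
    have hTk : (0 : ℝ) < T k := by exact_mod_cast hk.trans_le (hkT k)
    simp only [hρ, hT] at hTk ⊢
    field_simp
  have hlow : Tendsto (fun k : ℕ => (k : ℝ) ^ 4 / (T (k + 1) : ℝ)
      - ((T (k + 1) : ℝ) - T k) / T k) atTop (𝓝 c⁻¹) := by
    have h1 := (hρ1.inv₀ one_ne_zero).mul (h'.inv₀ hc.ne')
    have h2 := ((h'.mul hρ1).mul (h.inv₀ hc.ne')).sub_const 1
    have := h1.sub h2
    rw [mul_one, mul_inv_cancel₀ hc.ne', inv_one, one_mul, sub_self, sub_zero] at this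
    refine this.congr' ?_
    filter_upwards [eventually_gt_atTop 0] with k hk
    have : (0 : ℝ) < k := by exact_mod_cast hk
    have hTk : (0 : ℝ) < T k := by exact_mod_cast hk.trans_le (hkT k)
    have hTk' : (0 : ℝ) < T (k + 1) := by
      exact_mod_cast (Nat.succ_pos k).trans_le (hkT (k + 1))
    simp only [hρ, hT] at hTk hTk' ⊢
    field_simp
  refine tendsto_of_tendsto_of_tendsto_of_le_of_le' (hlow.comp hκtop) (hup.comp hκtop) ?_ ?_
  · filter_upwards [hκtop.eventually_gt_atTop 0] with m hm
    have hTk : (0 : ℝ) < T (κ m) := by exact_mod_cast hm.trans_le (hkT _)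
    have h1 : (T (κ m) : ℝ) ≤ m := by exact_mod_cast hκle m
    have h2 : (m : ℝ) ≤ T (κ m + 1) := by exact_mod_cast (hκlt m).le
    have hm0 : (0 : ℝ) < m := hTk.trans_le h1
    have h3 : ((κ m : ℕ) : ℝ) ^ 4 - (m - T (κ m)) ≤ x m := by
      have := hp.sub_le (hκle m)
      rw [hxT] at this
      exact_mod_cast this
    simp only [Function.comp]
    calc _ ≤ ((κ m : ℕ) : ℝ) ^ 4 / m - ((m : ℝ) - T (κ m)) / m := by
          refine sub_le_sub (by gcongr) ?_
          refine div_le_div₀ ?_ ?_ hTk h1 <;> linarith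
      _ = (((κ m : ℕ) : ℝ) ^ 4 - (m - T (κ m))) / m := by ring
      _ ≤ _ := by gcongr
  · filter_upwards [hκtop.eventually_gt_atTop 0] with m hm
    have hTk : (0 : ℝ) < T (κ m) := by exact_mod_cast hm.trans_le (hkT _)
    have h1 : (T (κ m) : ℝ) ≤ m := by exact_mod_cast hκle m
    have h2 : (x m : ℝ) ≤ ((κ m + 1 : ℕ) : ℝ) ^ 4 := by
      have := (lt_of_lt_hitNat hx (hκlt m)).le
      exact_mod_cast this
    simp only [Function.comp]
    calc (x m : ℝ) / m ≤ ((κ m + 1 : ℕ) : ℝ) ^ 4 / m := by gcongr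
      _ ≤ _ := by gcongr

theorem ae_tendsto_zero_of_tsum_lintegral {Ω : Type*} [MeasurableSpace Ω] {P : Measure Ω}
    {F : ℕ → Ω → ℝ≥0∞} (hF : ∀ k, Measurable (F k)) {b : ℕ → ℝ} (hb : Summable b)
    (hb0 : ∀ k, 0 ≤ b k)
    (h : ∀ k, ∫⁻ ω, F k ω ∂P ≤ ENNReal.ofReal (b k)) :
    ∀ᵐ ω ∂P, Tendsto (fun k => F k ω) atTop (𝓝 0) := by
  have h1 : ∫⁻ ω, ∑' k, F k ω ∂P ≠ ⊤ := by
    rw [lintegral_tsum fun k => (hF k).aemeasurable]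
    refine ne_top_of_le_ne_top ?_ (ENNReal.tsum_le_tsum h)
    rw [← ENNReal.ofReal_tsum_of_nonneg hb0 hb]
    exact ENNReal.ofReal_ne_top
  filter_upwards [ae_lt_top (Measurable.tsum hF) h1] with ω hω
  exact ENNReal.tendsto_atTop_zero_of_tsum_ne_top hω.ne

theorem tendsto_zero_of_tendsto_ofReal_sq {u : ℕ → ℝ}
    (h : Tendsto (fun k => ENNReal.ofReal (u k ^ 2)) atTop (𝓝 0)) : Tendsto u atTop (𝓝 0) := by
  have h1 := (ENNReal.tendsto_toReal ENNReal.zero_ne_top).comp h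
  simp only [Function.comp_def, ENNReal.toReal_ofReal (sq_nonneg _), ENNReal.toReal_zero] at h1
  have h2 := h1.sqrt
  simp only [Real.sqrt_sq_eq_abs, Real.sqrt_zero] at h2
  exact (tendsto_zero_iff_abs_tendsto_zero _).2 h2

namespace IsRegularWalk

variable {Ω : Type*} [MeasurableSpace Ω] {P : Measure Ω} [IsProbabilityMeasure P] {p q : ℝ≥0∞}
  {X : ℕ → Ω → ℤ} {r : ℝ}

theorem ae_tendsto_sum_tally (hX : IsRegularWalk P p q X) (hpq : p + q = 1)
    (hqr : q * ENNReal.ofReal r = p) (hr : 10 ≤ r) :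
    ∀ᵐ ω ∂P, Tendsto (fun k : ℕ => (∑ i ∈ Finset.range ((k + 1) ^ 4),
      (hX.tally ((k + 1) ^ 4) i ω : ℝ)) / ((k + 1 : ℕ) : ℝ) ^ 4) atTop (𝓝 (2 / (r - 3))) := by
  have hr3 : 0 < r - 3 := by linarith
  have hsum : Summable fun k : ℕ => 10 ^ 9 * r ^ 2 * (1 / ((k + 1 : ℕ) : ℝ) ^ 4) :=
    ((summable_nat_add_iff 1).2 (Real.summable_one_div_nat_pow.2 (by norm_num : 1 < 4))).mul_left _
  have hmeas : ∀ k : ℕ, Measurable fun ω => ((r - 3) * ∑ i ∈ Finset.range ((k + 1) ^ 4),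
      (hX.tally ((k + 1) ^ 4) i ω : ℝ) - 2 * ((k + 1) ^ 4 : ℕ)) := fun k =>
    ((Finset.measurable_fun_sum _ fun i _ =>
      (hX.isLeftChain hpq _).measurable_comp i fun z => (z : ℝ)).const_mul _).sub_const _
  have := ae_tendsto_zero_of_tsum_lintegral (P := P) (F := fun k ω => ENNReal.ofReal
    ((((r - 3) * ∑ i ∈ Finset.range ((k + 1) ^ 4), (hX.tally ((k + 1) ^ 4) i ω : ℝ)
      - 2 * ((k + 1) ^ 4 : ℕ)) / ((k + 1 : ℕ) : ℝ) ^ 4) ^ 2))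
    (fun k => (((hmeas k).div_const _).pow_const 2).ennreal_ofReal) hsum
    (fun k => by positivity) (fun k => ?_)
  · filter_upwards [this] with ω hω
    have h1 := ((tendsto_zero_of_tendsto_ofReal_sq hω).add_const 2).div_const (r - 3)
    rw [zero_add] at h1
    refine h1.congr fun k => ?_
    have : (0 : ℝ) < ((k + 1 : ℕ) : ℝ) := by positivity
    push_cast
    field_simp
    ring
  · have h1 := (hX.isLeftChain hpq ((k + 1) ^ 4)).lintegral_sum_sub_sq_le hpq hqr hr
      (Nat.one_le_pow _ _ (Nat.succ_pos k))
    set N : ℝ := ((k + 1 : ℕ) : ℝ) ^ 4 with hN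
    have hN0 : 0 < N := by positivity
    calc _ = ∫⁻ ω, ENNReal.ofReal ((N ^ 2)⁻¹) * ENNReal.ofReal (((r - 3) *
            ∑ i ∈ Finset.range ((k + 1) ^ 4), (hX.tally ((k + 1) ^ 4) i ω : ℝ)
              - 2 * ((k + 1) ^ 4 : ℕ)) ^ 2) ∂P := by
          refine lintegral_congr fun ω => ?_
          rw [← ENNReal.ofReal_mul (by positivity), div_pow, div_eq_inv_mul]
      _ ≤ ENNReal.ofReal ((N ^ 2)⁻¹) * ENNReal.ofReal (10 ^ 9 * r ^ 2 * ((k + 1) ^ 4 : ℕ)) := by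
          rw [lintegral_const_mul' _ _ ENNReal.ofReal_ne_top]
          gcongr
      _ = _ := by
          rw [← ENNReal.ofReal_mul (by positivity)]
          congr 1
          rw [Nat.cast_pow, ← hN]
          field_simp

theorem ae_tendsto_tsum_tally (hX : IsRegularWalk P p q X) (hpq : p + q = 1)
    (hqr : q * ENNReal.ofReal r = p) (hr : 10 ≤ r) :
    ∀ᵐ ω ∂P, Tendsto (fun k : ℕ => (∑' j, (hX.tally ((k + 1) ^ 4) ((k + 1) ^ 4 + j) ω : ℝ≥0∞))
      / ENNReal.ofReal (((k + 1 : ℕ) : ℝ) ^ 4)) atTop (𝓝 0) := by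
  have hsum : Summable fun k : ℕ => 10 ^ 9 * r * (1 / ((k + 1 : ℕ) : ℝ) ^ 2) :=
    ((summable_nat_add_iff 1).2 (Real.summable_one_div_nat_pow.2 (by norm_num : 1 < 2))).mul_left _
  refine ae_tendsto_zero_of_tsum_lintegral (fun k => ?_) hsum (fun k => ?_) (fun k => ?_)
  · exact (Measurable.tsum fun j =>
      (hX.isLeftChain hpq _).measurable_comp _ fun z => (z : ℝ≥0∞)).div_const _
  · have : 0 ≤ r := by linarith
    positivity
  · have h1 := (hX.isLeftChain hpq ((k + 1) ^ 4)).lintegral_tsum_tail_le_sqrt hpq hqr hr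
      (s := (k + 1) ^ 2) (Nat.one_le_pow _ _ (Nat.succ_pos k)) (by ring)
    have hN0 : (0 : ℝ) < ((k + 1 : ℕ) : ℝ) := by positivity
    simp only [div_eq_mul_inv]
    rw [lintegral_mul_const' _ _ (by simpa using pow_pos hN0 4)]
    calc _ ≤ _ := mul_le_mul_left h1 _
      _ = _ := by
        rw [← div_eq_mul_inv, ← ENNReal.ofReal_div_of_pos (by positivity)]
        congr 1
        rw [Nat.cast_pow]
        field_simp

theorem ae_tendsto_div (hX : IsRegularWalk P p q X) (hpq : p + q = 1)
    (hqr : q * ENNReal.ofReal r = p) (hr : 10 ≤ r) :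
    ∀ᵐ ω ∂P, Tendsto (fun m : ℕ => (X m ω : ℝ) / m) atTop (𝓝 ((r - 3) / (r + 1))) := by
  have hr3 : 0 < r - 3 := by linarith
  filter_upwards [hX.ae_tendsto_sum_tally hpq hqr hr, hX.ae_tendsto_tsum_tally hpq hqr hr]
    with ω hS hB
  have hc : (r - 3) / (r + 1) = (1 + 2 * (2 / (r - 3)) + 2 * 0)⁻¹ := by
    have : 0 < r + 1 := by linarith
    field_simp
    ring
  rw [hc]
  refine (hX.path ω).tendsto_div (hX.unbdd ω) (by positivity) ?_
  rw [← tendsto_add_atTop_iff_nat 1]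
  have hB' := (ENNReal.tendsto_toReal ENNReal.zero_ne_top).comp hB
  rw [ENNReal.toReal_zero] at hB'
  refine ((tendsto_const_nhds.add (hS.const_mul 2)).add (hB'.const_mul 2)).congr fun k => ?_
  set n := (k + 1) ^ 4 with hn
  have hn0 : (0 : ℝ) < ((k + 1 : ℕ) : ℝ) ^ 4 := by positivity
  have h := (hX.path ω).hitNat_eq (hX.unbdd ω) n
  change _ = _ + 2 * ∑' i : ℕ, (hX.tally n i ω : ℝ≥0∞) at h
  rw [← Summable.sum_add_tsum_nat_add' (k := n) ENNReal.summable] at h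
  simp only [add_comm _ n] at h
  set B := ∑' j, (hX.tally n (n + j) ω : ℝ≥0∞) with hBdef
  have hBtop : B ≠ ⊤ := by
    rintro hB
    rw [hB, add_top, ENNReal.mul_top two_ne_zero, add_top] at h
    exact ENNReal.natCast_ne_top _ h
  have h' := congrArg ENNReal.toReal h
  rw [ENNReal.toReal_natCast, ENNReal.toReal_add (by simp) (ENNReal.mul_ne_top (by simp)
    (ENNReal.add_ne_top.2 ⟨by simp, hBtop⟩)), ENNReal.toReal_mul, ENNReal.toReal_add (by simp) hBtop,
    ENNReal.toReal_sum (by simp)] at h'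
  simp only [ENNReal.toReal_natCast, ENNReal.toReal_ofNat] at h'
  rw [h', Function.comp, ENNReal.toReal_div, ENNReal.toReal_ofReal hn0.le, hn]
  rw [Nat.cast_pow]
  field_simp
  ring

end IsRegularWalk

theorem natSA_le {Ω : Type*} [mΩ : MeasurableSpace Ω] {X : ℕ → Ω → ℤ}
    (hX : ∀ n, Measurable (X n)) (n : ℕ) : natSA X n ≤ mΩ :=
  iSup₂_le fun m _ => (hX m).comap_le

theorem natSA_mono {Ω : Type*} (X : ℕ → Ω → ℤ) : Monotone (natSA X) := fun _ _ h =>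
  biSup_mono fun _ hm => Finset.range_subset_range.2 (Nat.succ_le_succ h) hm

theorem measurable_natSA {Ω : Type*} (X : ℕ → Ω → ℤ) {m n : ℕ} (h : m ≤ n) :
    Measurable[natSA X n] (X m) := by
  rw [measurable_iff_comap_le]
  exact le_biSup (fun m => MeasurableSpace.comap (X m) ⊤) (Finset.mem_range.2 (Nat.lt_succ_of_le h))

namespace IsCookieRW

variable {Ω : Type*} [MeasurableSpace Ω] {P : Measure Ω}

theorem measurableSet_right {env : ℤ → ℝ} {X : ℕ → Ω → ℤ} (hX : IsCookieRW P env X) (k : ℕ) :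
    MeasurableSet {ω | X (k + 1) ω = X k ω + 1} :=
  measurableSet_eq_fun (hX.meas _) ((hX.meas k).add_const 1)

theorem ae_bounded {env : ℤ → ℝ} {X : ℕ → Ω → ℤ} (hX : IsCookieRW P env X)
    (hX0 : ∀ᵐ ω ∂P, X 0 ω = 0) (n : ℕ) : ∀ᵐ ω ∂P, |X n ω| ≤ n := by
  induction n with
  | zero => filter_upwards [hX0] with ω hω; simp [hω]
  | succ n ih =>
    filter_upwards [ih, hX.steps n] with ω h1 h2
    have := abs_add_le (X n ω) (X (n + 1) ω - X n ω)
    rw [add_sub_cancel] at this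
    push_cast
    omega

variable [IsProbabilityMeasure P]

theorem measureReal_right {p : ℝ} {X : ℕ → Ω → ℤ} (hX : IsCookieRW P (fun _ => p) X) (k : ℕ)
    (y : ℕ → ℤ) :
    P.real ({ω | ∀ j ≤ k, X j ω = y j} ∩ {ω | X (k + 1) ω = X k ω + 1})
      = (if ∀ m < k, ¬(y m = y k ∧ y (m + 1) = y m - 1) then p else 1 / 2)
        * P.real {ω | ∀ j ≤ k, X j ω = y j} := by
  set B := {ω | ∀ j ≤ k, X j ω = y j} with hB
  have hBm : MeasurableSet[natSA X k] B := by
    have : B = ⋂ j ≤ k, X j ⁻¹' {y j} := by ext; simp [hB]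
    rw [this]
    exact MeasurableSet.biInter (Set.to_countable _) fun j hj =>
      measurable_natSA X hj (measurableSet_singleton _)
  have hR := hX.measurableSet_right k
  have h := setIntegral_condExp (natSA_le hX.meas k)
    ((integrable_const (1 : ℝ)).indicator hR (μ := P)) hBm
  rw [setIntegral_congr_ae (natSA_le hX.meas k _ hBm) ((hX.cond k).mono fun ω hω _ => hω),
    setIntegral_indicator hR, setIntegral_const, smul_eq_mul, mul_one] at h
  rw [← h]
  have hconst : ∀ ω ∈ B, p * (freshEvent X k).indicator (fun _ => (1 : ℝ)) ω
      + 1 / 2 * (freshEvent X k)ᶜ.indicator (fun _ => (1 : ℝ)) ω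
      = if ∀ m < k, ¬(y m = y k ∧ y (m + 1) = y m - 1) then p else 1 / 2 := by
    intro ω hω
    have hiff : ω ∈ freshEvent X k ↔ ∀ m < k, ¬(y m = y k ∧ y (m + 1) = y m - 1) := by
      refine forall₂_congr fun m hm => ?_
      rw [hω m hm.le, hω k le_rfl, hω (m + 1) hm]
    by_cases hf : ω ∈ freshEvent X k
    · rw [if_pos (hiff.1 hf)]
      simp [hf]
    · rw [if_neg (mt hiff.2 hf)]
      simp [hf]
  rw [setIntegral_congr_fun (natSA_le hX.meas k _ hBm) hconst, setIntegral_const, smul_eq_mul,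
    mul_comm]

theorem ae_unbounded {env : ℤ → ℝ} {X : ℕ → Ω → ℤ} (hX : IsCookieRW P env X)
    (hX0 : ∀ᵐ ω ∂P, X 0 ω = 0) : ∀ᵐ ω ∂P, ∀ n : ℕ, ∃ k, (n : ℤ) ≤ X k ω := by
  let 𝒢 : Filtration ℕ (‹MeasurableSpace Ω›) := ⟨natSA X, natSA_mono X, natSA_le hX.meas⟩
  have hint : ∀ n, Integrable (fun ω => (X n ω : ℝ)) P := fun n => by
    refine Integrable.of_bound
      ((measurable_of_countable (fun z : ℤ => (z : ℝ))).comp (hX.meas n)).aestronglyMeasurable n ?_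
    filter_upwards [hX.ae_bounded hX0 n] with ω hω
    rw [Real.norm_eq_abs]
    exact_mod_cast hω
  have hsub : Submartingale (fun n ω => (X n ω : ℝ)) 𝒢 P := by
    refine submartingale_of_condExp_sub_nonneg_nat (fun n => ?_) hint fun n => ?_
    · exact ((measurable_of_countable (fun z : ℤ => (z : ℝ))).comp
        (measurable_natSA X le_rfl)).stronglyMeasurable
    · set I : Ω → ℝ := Set.indicator {ω | X (n + 1) ω = X n ω + 1} (fun _ => (1 : ℝ)) with hI
      have hIint : Integrable I P := (integrable_const (1 : ℝ)).indicator (hX.measurableSet_right n)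
      have h1 : (fun ω => (X (n + 1) ω : ℝ)) - (fun ω => (X n ω : ℝ))
          =ᵐ[P] (2 : ℝ) • I - fun _ => (1 : ℝ) := by
        filter_upwards [hX.steps n] with ω hω
        simp only [Pi.sub_apply, Pi.smul_apply, hI, smul_eq_mul]
        rcases (abs_eq zero_le_one).1 hω with h | h
        · have h' : X (n + 1) ω = X n ω + 1 := by omega
          rw [Set.indicator_of_mem (by exact h'), h']
          push_cast
          ring
        · have h' : X (n + 1) ω = X n ω - 1 := by omega
          rw [Set.indicator_of_notMem (by simp only [Set.mem_ofPred_eq]; omega), h']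
          push_cast
          ring
      have h2 := condExp_congr_ae (m := natSA X n) h1
      have h3 := condExp_sub (μ := P) (hIint.smul (2 : ℝ)) (integrable_const (1 : ℝ)) (natSA X n)
      have h4 := condExp_smul (μ := P) (2 : ℝ) I (natSA X n)
      have h5 := condExp_const (μ := P) (natSA_le hX.meas n) (1 : ℝ)
      change 0 ≤ᵐ[P] P[_ | natSA X n]
      filter_upwards [h2, h3, h4, hX.cond n] with ω e2 e3 e4 e5
      rw [e2, e3, Pi.sub_apply, e4, h5, Pi.smul_apply, e5, smul_eq_mul]
      have := (hX.envRange (X n ω)).1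
      by_cases hf : ω ∈ freshEvent X n
      · simp [hf]
        linarith
      · simp [hf]
  have hconv := hsub.bddAbove_iff_exists_tendsto (R := 1) <| by
    filter_upwards [ae_all_iff.2 hX.steps] with ω hω n
    rw [NNReal.coe_one]
    exact_mod_cast (hω n).le
  filter_upwards [hconv, ae_all_iff.2 hX.steps] with ω hω hstep
  by_contra! hbd
  obtain ⟨n, hn⟩ := hbd
  obtain ⟨c, hc⟩ := hω.1 ⟨n, by
    rintro _ ⟨k, rfl⟩
    have := (hn k).le
    dsimp only
    exact_mod_cast this⟩
  have h0 := (((tendsto_add_atTop_iff_nat 1).2 hc).sub hc).abs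
  rw [sub_self, abs_zero] at h0
  have h1 : Tendsto (fun n => |(X (n + 1) ω : ℝ) - X n ω|) atTop (𝓝 1) :=
    tendsto_const_nhds.congr fun n => by exact_mod_cast (hstep n).symm
  exact zero_ne_one (tendsto_nhds_unique h0 h1)

theorem exists_isRegularWalk {p : ℝ} {X : ℕ → Ω → ℤ} (hX : IsCookieRW P (fun _ => p) X)
    (hX0 : ∀ᵐ ω ∂P, X 0 ω = 0) : ∃ Y : ℕ → Ω → ℤ,
      IsRegularWalk P (ENNReal.ofReal p) (ENNReal.ofReal (1 - p)) Y
      ∧ ∀ᵐ ω ∂P, ∀ n, X n ω = Y n ω := by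
  classical
  set G := {ω | X 0 ω = 0 ∧ (∀ n, |X (n + 1) ω - X n ω| = 1) ∧ ∀ n : ℕ, ∃ k, (n : ℤ) ≤ X k ω}
    with hG
  have hGm : MeasurableSet G := by
    have hm := hX.meas
    have h1 : G = {ω | X 0 ω = 0} ∩ ((⋂ n, {ω | |X (n + 1) ω - X n ω| = 1})
        ∩ ⋂ n : ℕ, ⋃ k, {ω | (n : ℤ) ≤ X k ω}) := by
      ext
      simp [hG]
    rw [h1]
    refine (measurableSet_eq_fun (hm 0) measurable_const).inter (MeasurableSet.inter ?_ ?_)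
    · exact MeasurableSet.iInter fun n => measurableSet_eq_fun
        ((measurable_of_countable fun z : ℤ => |z|).comp ((hm (n + 1)).sub (hm n))) measurable_const
    · exact MeasurableSet.iInter fun n => MeasurableSet.iUnion fun k =>
        measurableSet_le measurable_const (hm k)
  have hGae : ∀ᵐ ω ∂P, ω ∈ G := by
    filter_upwards [hX0, ae_all_iff.2 hX.steps, hX.ae_unbounded hX0] with ω h1 h2 h3
    exact ⟨h1, h2, h3⟩
  set Y : ℕ → Ω → ℤ := fun n ω => if ω ∈ G then X n ω else n with hY
  have hXY : ∀ᵐ ω ∂P, ∀ n, X n ω = Y n ω := by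
    filter_upwards [hGae] with ω hω n
    simp [hY, hω]
  have hYm : ∀ n, Measurable (Y n) := fun n => (hX.meas n).ite hGm measurable_const
  have hset : ∀ k ω₀, {ω | ∀ j ≤ k, X j ω = Y j ω₀} =ᵐ[P] hist Y k ⁻¹' {hist Y k ω₀} := by
    intro k ω₀
    filter_upwards [hXY] with ω hω
    refine propext ?_
    change (∀ j ≤ k, X j ω = Y j ω₀) ↔ hist Y k ω = hist Y k ω₀
    rw [hist_eq_iff]
    simp only [hω]
  have hright : ∀ k, {ω | X (k + 1) ω = X k ω + 1} =ᵐ[P] {ω | Y (k + 1) ω = Y k ω + 1} := by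
    intro k
    filter_upwards [hXY] with ω hω
    refine propext ?_
    change X (k + 1) ω = X k ω + 1 ↔ Y (k + 1) ω = Y k ω + 1
    rw [hω, hω]
  have hp := hX.envRange 0
  refine ⟨Y, ⟨hYm, fun ω => ?_, fun ω => ?_, fun k ω₀ => ?_, fun k ω₀ => ?_⟩, hXY⟩
  · by_cases hω : ω ∈ G
    · refine ⟨by simpa [hY, hω] using hω.1, fun k => ?_⟩
      have := (abs_eq zero_le_one).1 (hω.2.1 k)
      simp only [hY, hω, if_true]
      omega
    · exact ⟨by simp [hY, hω], fun k => by simp [hY, hω]⟩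
  · by_cases hω : ω ∈ G
    · simpa [hY, hω] using hω.2.2
    · exact fun n => ⟨n, by simp [hY, hω]⟩
  · have h := hX.measureReal_right k (fun j => Y j ω₀)
    rw [← measure_congr ((hset k ω₀).inter (hright k)), ← measure_congr (hset k ω₀),
      ← ofReal_measureReal, h, ENNReal.ofReal_mul (by split_ifs <;> linarith [hp.1]),
      ofReal_measureReal]
    congr 1
    split_ifs <;> simp
  · have h := hX.measureReal_right k (fun j => Y j ω₀)
    have h' := measureReal_inter_add_sdiff (μ := P) (s := {ω | ∀ j ≤ k, X j ω = Y j ω₀})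
      (hX.measurableSet_right k)
    rw [← measure_congr ((hset k ω₀).inter (hright k).compl), ← measure_congr (hset k ω₀),
      ← ofReal_measureReal, ← Set.sdiff_eq, ← sub_eq_of_eq_add' h'.symm, h, ← one_sub_mul,
      ENNReal.ofReal_mul (by split_ifs <;> linarith [hp.2]), ofReal_measureReal]
    congr 1
    split_ifs
    · rfl
    · rw [show (1 : ℝ) - 1 / 2 = 2⁻¹ by norm_num, ENNReal.ofReal_inv_of_pos two_pos]
      simp

end IsCookieRW

/-- For `p ∈ [10/11, 1)` the speed of the homogeneous walk started at `0` equals `4p - 3`. -/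
theorem stmt11 (p : ℝ) (hp : p ∈ Set.Ico (10 / 11 : ℝ) 1)
    {Ω : Type*} [MeasurableSpace Ω] (P : Measure Ω) [IsProbabilityMeasure P]
    (X : ℕ → Ω → ℤ) (hX : IsCookieRW P (fun _ => p) X) (hX0 : ∀ᵐ ω ∂P, X 0 ω = 0) :
    ∀ᵐ ω ∂P, Tendsto (fun n : ℕ => (X n ω : ℝ) / n) atTop (nhds (4 * p - 3)) := by
  obtain ⟨hp1, hp2⟩ := hp
  obtain ⟨Y, hY, hXY⟩ := hX.exists_isRegularWalk hX0
  have hq : 0 < 1 - p := by linarith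
  have hlim := hY.ae_tendsto_div (r := p / (1 - p))
    (by rw [← ENNReal.ofReal_add (by linarith) hq.le]; simp)
    (by rw [← ENNReal.ofReal_mul hq.le, mul_div_cancel₀ _ hq.ne'])
    (by rw [le_div_iff₀ hq]; linarith)
  filter_upwards [hlim, hXY] with ω h1 h2
  have : 4 * p - 3 = (p / (1 - p) - 3) / (p / (1 - p) + 1) := by
    field_simp
    ring
  simpa only [h2, this] using h1
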